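/- Let p, n ∈ ℤ⁺ with n ≥ 2, let α ≥ 4 and K > 0. For any ε ∈ (0,1) there exist a single measurable test φ : ℝ^{p×n} → {0,1} (not depending on the sparsity level) and a constant C > 0 depending only on α, K and ε such that for every integer s with 1 ≤ s ≤ p, R_{P_{α,K}^⊗}(ρ, φ) ≤ ε (with sparsity level s in the alternative space Θ(p,n,s,ρ)) as long as ρ² ≥ C·min(p^{max(2/α,1/2)}·log log(8n), s(p/s)^{2/α} + log log(8n)). -/

import Mathlib

open MeasureTheory
open scoped Classical

namespace ChangePoint

noncomputable section

/-- The `i`-th column (0-based) of the data matrix, with out-of-range guard. -/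
def col (p n : ℕ) (X : Fin n → Fin p → ℝ) (i : ℕ) : Fin p → ℝ :=
  if h : i < n then X ⟨i, h⟩ else 0

/-- ℓ₀-"norm": the number of nonzero coordinates. -/
def l0 (p : ℕ) (v : Fin p → ℝ) : ℕ :=
  (Finset.univ.filter fun j : Fin p => v j ≠ 0).card

/-- Squared Euclidean norm on `ℝ^p`. -/
def sqnorm (p : ℕ) (v : Fin p → ℝ) : ℝ := ∑ j, v j ^ 2

/-- The iterated logarithm `log log (8 n)`. -/
def LL (n : ℕ) : ℝ := Real.log (Real.log (8 * n))

/-- The sub-Weibull class `𝒢_{α,K}` of distributions on `ℝ`: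
mean `0`, variance `1` and `𝔼 exp (|W/K|^α) ≤ 2`. -/
def memG (α K : ℝ) (ν : Measure ℝ) : Prop :=
  IsProbabilityMeasure ν ∧ Integrable id ν ∧ (∫ x, x ∂ν) = 0 ∧
    (∫⁻ x, ENNReal.ofReal (x ^ 2) ∂ν) = 1 ∧
    (∫⁻ x, ENNReal.ofReal (Real.exp (|x / K| ^ α)) ∂ν) ≤ 2

/-- The polynomially-tailed class `𝒫_{α,K}` of distributions on `ℝ`:
mean `0`, variance `1` and `𝔼 |W/K|^α ≤ 1`. -/
def memP (α K : ℝ) (ν : Measure ℝ) : Prop :=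
  IsProbabilityMeasure ν ∧ Integrable id ν ∧ (∫ x, x ∂ν) = 0 ∧
    (∫⁻ x, ENNReal.ofReal (x ^ 2) ∂ν) = 1 ∧
    (∫⁻ x, ENNReal.ofReal (|x / K| ^ α) ∂ν) ≤ 1

/-- `P` is the joint law on `ℝ^{p×n}` of `p·n` independent entries with marginal laws `ν t j`
(characterised on measurable rectangles). -/
def IsEntrywiseProduct (p n : ℕ) (P : Measure (Fin n → Fin p → ℝ))
    (ν : Fin n → Fin p → Measure ℝ) : Prop :=
  IsProbabilityMeasure P ∧
    ∀ s : Fin n → Fin p → Set ℝ, (∀ t j, MeasurableSet (s t j)) →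
      P {x | ∀ t j, x t j ∈ s t j} = ∏ t, ∏ j, ν t j (s t j)

/-- The class `𝒢_{α,K}^⊗` of noise distributions. -/
def Gclass (p n : ℕ) (α K : ℝ) : Set (Measure (Fin n → Fin p → ℝ)) :=
  {P | ∃ ν : Fin n → Fin p → Measure ℝ, (∀ t j, memG α K (ν t j)) ∧ IsEntrywiseProduct p n P ν}

/-- The class `𝒫_{α,K}^⊗` of noise distributions. -/
def Pclass (p n : ℕ) (α K : ℝ) : Set (Measure (Fin n → Fin p → ℝ)) :=
  {P | ∃ ν : Fin n → Fin p → Measure ℝ, (∀ t j, memP α K (ν t j)) ∧ IsEntrywiseProduct p n P ν}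

/-- The null parameter space `Θ₀(p,n)`: constant signal. -/
def Theta0 (p n : ℕ) : Set (Fin n → Fin p → ℝ) :=
  {θ | ∃ μ : Fin p → ℝ, ∀ t, θ t = μ}

/-- `Θ^{(t₀)}(p,n,s,ρ)`: a single mean change at (1-based) time `t0` of sparsity `s` and
normalized signal strength at least `ρ`. -/
def ThetaAt (p n t0 s : ℕ) (ρ : ℝ) : Set (Fin n → Fin p → ℝ) :=
  {θ | ∃ μ₁ μ₂ : Fin p → ℝ,
    (∀ t : Fin n, (t : ℕ) < t0 → θ t = μ₁) ∧
    (∀ t : Fin n, t0 ≤ (t : ℕ) → θ t = μ₂) ∧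
    l0 p (fun j => μ₁ j - μ₂ j) ≤ s ∧
    ρ ^ 2 ≤ (t0 : ℝ) * ((n : ℝ) - (t0 : ℝ)) / (n : ℝ) * sqnorm p (fun j => μ₁ j - μ₂ j)}

/-- The single-change-point alternative `Θ(p,n,s,ρ)`. -/
def Theta1 (p n s : ℕ) (ρ : ℝ) : Set (Fin n → Fin p → ℝ) :=
  ⋃ t0 ∈ Finset.Icc 1 (n - 1), ThetaAt p n t0 s ρ

/-- A (randomized-free) test: a measurable `{0,1}`-valued function of the data. -/
def IsTest (p n : ℕ) (φ : (Fin n → Fin p → ℝ) → ℝ) : Prop :=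
  Measurable φ ∧ ∀ x, φ x = 0 ∨ φ x = 1

/-- The worst-case testing error of the test `φ` for null `Θ₀(p,n)` against the
alternative `Θalt`, over the noise class `Q`. -/
def risk (p n : ℕ) (Q : Set (Measure (Fin n → Fin p → ℝ)))
    (Θalt : Set (Fin n → Fin p → ℝ)) (φ : (Fin n → Fin p → ℝ) → ℝ) : ℝ :=
  (⨆ P ∈ Q, ⨆ θ ∈ Theta0 p n, ∫ E, φ (θ + E) ∂P) +
  (⨆ P ∈ Q, ⨆ θ ∈ Θalt, ∫ E, (1 - φ (θ + E)) ∂P)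

/-- The dyadic grid `𝒯 = {1,2,4,…,2^{⌊log₂(n/2)⌋}}`. -/
def Tgrid (n : ℕ) : Finset ℕ :=
  (Finset.range (Nat.log 2 (n / 2) + 1)).image fun k => 2 ^ k

/-- The CUSUM-type statistic `Y_t`. -/
def Yt (p n : ℕ) (X : Fin n → Fin p → ℝ) (t : ℕ) (j : Fin p) : ℝ :=
  (∑ i ∈ Finset.range t, (col p n X i j - col p n X (n - 1 - i) j)) / Real.sqrt (2 * t)

/-- `A_t = ∑_j (Y_t(j)² − 1)`. -/
def At (p n : ℕ) (X : Fin n → Fin p → ℝ) (t : ℕ) : ℝ :=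
  ∑ j, (Yt p n X t j ^ 2 - 1)

/-- The dense sub-Weibull test `φ_{𝒢,dense}` with threshold `r`. -/
def phiGdense (p n : ℕ) (r : ℝ) (X : Fin n → Fin p → ℝ) : ℝ :=
  if ∃ t ∈ Tgrid n, r < At p n X t then 1 else 0

/-- Sample-splitting statistic `Y_{t,1}` (odd-indexed observations). -/
def Yt1 (p n : ℕ) (X : Fin n → Fin p → ℝ) (t : ℕ) (j : Fin p) : ℝ :=
  (∑ i ∈ Finset.range (t / 2), (col p n X (2 * i) j - col p n X (n - 1 - 2 * i) j)) /
    Real.sqrt t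

/-- Sample-splitting statistic `Y_{t,2}` (even-indexed observations). -/
def Yt2 (p n : ℕ) (X : Fin n → Fin p → ℝ) (t : ℕ) (j : Fin p) : ℝ :=
  (∑ i ∈ Finset.range (t / 2), (col p n X (2 * i + 1) j - col p n X (n - 2 - 2 * i) j)) /
    Real.sqrt t

/-- `Y_1 = (X_1 − X_n)/√2`. -/
def Y1 (p n : ℕ) (X : Fin n → Fin p → ℝ) (j : Fin p) : ℝ :=
  (col p n X 0 j - col p n X (n - 1) j) / Real.sqrt 2

/-- The hard-thresholded statistic `A_{t,a}`. -/
def Ata (p n : ℕ) (X : Fin n → Fin p → ℝ) (t : ℕ) (a : ℝ) : ℝ :=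
  if t = 1 then ∑ j, (Y1 p n X j ^ 2 - 1) * (if a ≤ |Y1 p n X j| then 1 else 0)
  else ∑ j, (Yt1 p n X t j ^ 2 - 1) * (if a ≤ |Yt2 p n X t j| then 1 else 0)

/-- The sparse sub-Weibull test `φ_{𝒢,sparse}` with threshold parameters `a, r, r₁`. -/
def phiGsparse (p n : ℕ) (a r r₁ : ℝ) (X : Fin n → Fin p → ℝ) : ℝ :=
  if (∃ t ∈ Tgrid n, t ≠ 1 ∧ r < Ata p n X t a) ∨ r₁ < Ata p n X 1 a then 1 else 0

/-- The median of a list of reals: its `⌈m/2⌉`-th smallest element. -/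
def median (l : List ℝ) : ℝ :=
  (l.insertionSort (· ≤ ·)).getD ((l.length + 1) / 2 - 1) 0

/-- `Z_i = (X_i − X_{n+1−i})/√2` (0-based index `i`). -/
def Zb (p n : ℕ) (X : Fin n → Fin p → ℝ) (i : ℕ) (j : Fin p) : ℝ :=
  (col p n X i j - col p n X (n - 1 - i) j) / Real.sqrt 2

/-- Mean of the `g`-th (0-based) of `G` consecutive equal-size groups of `Z_1,…,Z_t`. -/
def groupMean (p n : ℕ) (X : Fin n → Fin p → ℝ) (t G g : ℕ) (j : Fin p) : ℝ :=
  (∑ i ∈ Finset.range (t / G), Zb p n X (g * (t / G) + i) j) / ((t / G : ℕ) : ℝ)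

/-- The median-of-means statistic `A_t^{MoM}` with `G` groups. -/
def AMoM (p n : ℕ) (X : Fin n → Fin p → ℝ) (t G : ℕ) : ℝ :=
  (t : ℝ) * median (List.ofFn fun g : Fin G =>
    ∑ j, (groupMean p n X t G (g : ℕ) j ^ 2 - (G : ℝ) / (t : ℝ)))

/-- `Δ = 2^{3+⌈log₂ log log (8n)⌉}`. -/
def DeltaDense (n : ℕ) : ℕ := 2 ^ (3 + (Int.ceil (Real.logb 2 (LL n))).toNat)

/-- The dense median-of-means test `φ_{𝒫,dense}`. -/
def phiPdense (p n : ℕ) (α C₁ : ℝ) (X : Fin n → Fin p → ℝ) : ℝ :=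
  if ∃ t ∈ Tgrid n,
      1 < AMoM p n X t (min t (DeltaDense n)) /
        (C₁ * (p : ℝ) ^ max ((1 : ℝ) / 2) (2 / α) * ((min t (DeltaDense n) : ℕ) : ℝ))
  then 1 else 0

/-- `Δ = 2^{4+⌈log₂ log log (8n)⌉}`. -/
def DeltaSparse (n : ℕ) : ℕ := 2 ^ (4 + (Int.ceil (Real.logb 2 (LL n))).toNat)

/-- Mean of the `g`-th (0-based) of `G` consecutive equal-size groups of the odd-indexed
`Z_1, Z_3, …, Z_{t−1}`. -/
def groupMeanOdd (p n : ℕ) (X : Fin n → Fin p → ℝ) (t G g : ℕ) (j : Fin p) : ℝ :=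
  (∑ i ∈ Finset.range (t / (2 * G)), Zb p n X (2 * (g * (t / (2 * G)) + i)) j) /
    ((t / (2 * G) : ℕ) : ℝ)

/-- The hard-thresholded median-of-means statistic `A_{t,a}^{MoM}` with `G` groups. -/
def AMoMa (p n : ℕ) (X : Fin n → Fin p → ℝ) (t G : ℕ) (a : ℝ) : ℝ :=
  if t = 1 then ∑ j, (Zb p n X 0 j ^ 2 - 1) * (if a ≤ |Zb p n X 0 j| then 1 else 0)
  else ((t : ℝ) / 2) * median (List.ofFn fun g : Fin G =>
    ∑ j, (groupMeanOdd p n X t G (g : ℕ) j ^ 2 - 2 * (G : ℝ) / (t : ℝ)) *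
      (if a ≤ |Yt2 p n X t j| then 1 else 0))

/-- The sparse median-of-means test `φ_{𝒫,sparse}^{MoM}`. -/
def phiPsparseMoM (p n s : ℕ) (α C₁ C₂ : ℝ) (X : Fin n → Fin p → ℝ) : ℝ :=
  if ∃ t ∈ Tgrid n,
      1 < AMoMa p n X t (min t (DeltaSparse n) / 2)
            (C₁ * (((p : ℝ) / (s : ℝ)) ^ ((1 : ℝ) / α) +
              ((s : ℝ) ^ (-(1 : ℝ) / 2)) * Real.sqrt (LL n))) /
          (C₂ * (if t = 1 then (s : ℝ) * ((p : ℝ) / (s : ℝ)) ^ ((2 : ℝ) / α)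
                 else Real.sqrt (s : ℝ) * ((min t (DeltaSparse n) / 2 : ℕ) : ℝ)))
  then 1 else 0

/-- Condition RSM for `(α, K)` with constants `C₁, C₂`: statistical guarantee for a family
of (measurable) robust sparse mean estimators. -/
def CondRSM (p s : ℕ) (α K C₁ C₂ : ℝ)
    (est : (m : ℕ) → (Fin m → Fin p → ℝ) → ℝ → Fin p → ℝ) : Prop :=
  (∀ m : ℕ, Measurable fun Wη : (Fin m → Fin p → ℝ) × ℝ => est m Wη.1 Wη.2) ∧
  ∀ (m : ℕ) (μW : Fin p → ℝ) (ν : Fin m → Measure (Fin p → ℝ))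
    (P : Measure (Fin m → Fin p → ℝ)) (η : ℝ),
    0 < η → η < 1 → l0 p μW ≤ s →
    (∀ i, IsProbabilityMeasure (ν i)) →
    (∀ i j, Integrable (fun w => w j) (ν i) ∧ (∫ w, w j ∂ν i) = μW j) →
    (∀ i j k, Integrable (fun w => (w j - μW j) * (w k - μW k)) (ν i) ∧
      (∫ w, (w j - μW j) * (w k - μW k) ∂ν i) = if j = k then 1 else 0) →
    (∀ i j, (∫⁻ w, ENNReal.ofReal (|w j - μW j| ^ α) ∂ν i) ≤
      ENNReal.ofReal ((Real.sqrt 2 * K) ^ α)) →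
    IsProbabilityMeasure P →
    (∀ S : Fin m → Set (Fin p → ℝ), (∀ i, MeasurableSet (S i)) →
      P {W | ∀ i, W i ∈ S i} = ∏ i, ν i (S i)) →
    C₁ * ((s : ℝ) * Real.log (Real.exp 1 * (p : ℝ) / (s : ℝ)) + Real.log (1 / η)) ≤ (m : ℝ) →
    ENNReal.ofReal (1 - η) ≤
      P {W | Real.sqrt (sqnorm p fun j => est m W η j - μW j) ≤
        Real.sqrt C₂ * (Real.sqrt ((s : ℝ) * Real.log (Real.exp 1 * (p : ℝ) / (s : ℝ)) / (m : ℝ)) +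
          Real.sqrt (Real.log (1 / η) / (m : ℝ)))}

/-- `Δ̃₁ = C₅ (s log(ep/s) + log(16/ε))`. -/
def rsmDelta1 (p s : ℕ) (ε C₅ : ℝ) : ℝ :=
  C₅ * ((s : ℝ) * Real.log (Real.exp 1 * (p : ℝ) / (s : ℝ)) + Real.log (16 / ε))

/-- `Δ̃₂ = C₅ (s log(ep/s) + log(16 log(2n)/ε))`. -/
def rsmDelta2 (p s n : ℕ) (ε C₅ : ℝ) : ℝ :=
  C₅ * ((s : ℝ) * Real.log (Real.exp 1 * (p : ℝ) / (s : ℝ)) +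
    Real.log (16 * Real.log (2 * (n : ℝ)) / ε))

/-- `a = C₃ ((p/s)^{1/α} + s^{−1/2} log^{1/2}(log Δ̃₁))`. -/
def rsmA (p s : ℕ) (α ε C₃ C₅ : ℝ) : ℝ :=
  C₃ * (((p : ℝ) / (s : ℝ)) ^ ((1 : ℝ) / α) +
    ((s : ℝ) ^ (-(1 : ℝ) / 2)) * Real.sqrt (Real.log (Real.log (rsmDelta1 p s ε C₅))))

/-- The sparse test `φ^{RSM}_{𝒫,sparse}` built from a robust sparse mean estimator `est`. -/
def phiRSM (p n s : ℕ) (est : (m : ℕ) → (Fin m → Fin p → ℝ) → ℝ → Fin p → ℝ)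
    (α ε C₃ C₄ C₅ C₆ : ℝ) (X : Fin n → Fin p → ℝ) : ℝ :=
  if (∃ t ∈ Tgrid n, (t : ℝ) ≤ rsmDelta1 p s ε C₅ ∧
        1 < Ata p n X t (rsmA p s α ε C₃ C₅) /
          (C₄ * (if t = 1 then (s : ℝ) * ((p : ℝ) / (s : ℝ)) ^ ((2 : ℝ) / α)
                 else Real.sqrt ((s : ℝ) * Real.log (rsmDelta1 p s ε C₅))))) ∨
     (∃ t ∈ Tgrid n, rsmDelta1 p s ε C₅ < (t : ℝ) ∧
        1 < (t : ℝ) * sqnorm p (est t (fun i : Fin t => fun j => Zb p n X (i : ℕ) j)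
              (Real.exp ((s : ℝ) * Real.log (Real.exp 1 * (p : ℝ) / (s : ℝ)) -
                min (t : ℝ) (rsmDelta2 p s n ε C₅) / C₅))) /
          (C₆ * min (t : ℝ) (rsmDelta2 p s n ε C₅)))
  then 1 else 0

/-- The multiple-change-point alternative `Θ_multi(p,n,ρ)`. -/
def ThetaMulti (p n : ℕ) (ρ : ℝ) : Set (Fin n → Fin p → ℝ) :=
  {θ | ∃ k : ℕ, 1 ≤ k ∧ ∃ τ : ℕ → ℕ, ∃ μ : ℕ → Fin p → ℝ,
    τ 0 = 0 ∧ τ (k + 1) = n ∧ (∀ i ≤ k, τ i < τ (i + 1)) ∧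
    (∀ i, 1 ≤ i → i ≤ k + 1 →
      ∀ t : Fin n, τ (i - 1) ≤ (t : ℕ) → (t : ℕ) < τ i → θ t = μ i) ∧
    ∃ i, 1 ≤ i ∧ i ≤ k ∧
      4 * Real.log (n : ℝ) ≤ ((min (τ i - τ (i - 1)) (τ (i + 1) - τ i) : ℕ) : ℝ) ∧
      ρ ^ 2 ≤ sqnorm p (fun j => μ (i + 1) j - μ i j) *
        ((min (τ i - τ (i - 1)) (τ (i + 1) - τ i) : ℕ) : ℝ)}

/-- Membership in the temporal-dependence class `𝒫_Temp`: independent rows, entrywise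
`𝒫_{α,K}` marginals, and exponentially decaying interlaced α-mixing coefficients. -/
def memPTemp (p n : ℕ) (α K c₁ c₂ : ℝ) (P : Measure (Fin n → Fin p → ℝ)) : Prop :=
  IsProbabilityMeasure P ∧
  (∀ s : Fin p → Set (Fin n → ℝ), (∀ j, MeasurableSet (s j)) →
    P {x | ∀ j, (fun t => x t j) ∈ s j} = ∏ j, P {x | (fun t => x t j) ∈ s j}) ∧
  (∀ t j, memP α K (P.map fun x => x t j)) ∧
  (∀ i : ℕ, 1 ≤ i → i ≤ n - 1 →
    ∀ S T : Set (Fin n),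
      (∀ s' ∈ S, ∀ t' ∈ T, (i : ℤ) ≤ |((s' : ℕ) : ℤ) - ((t' : ℕ) : ℤ)|) →
      ∀ A B : Set (Fin n → Fin p → ℝ),
        MeasurableSet[MeasurableSpace.comap (fun x (t : S) => x t.1) inferInstance] A →
        MeasurableSet[MeasurableSpace.comap (fun x (t : T) => x t.1) inferInstance] B →
        |(P (A ∩ B)).toReal - (P A).toReal * (P B).toReal| ≤ c₁ * Real.exp (-c₂ * (i : ℝ)))

/-- The class `𝒲_α` of distributions on `ℝ^p`: centered with `𝔼|⟨W,v⟩|^α ≤ 1` for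
every unit vector `v`. -/
def memW (p : ℕ) (α : ℝ) (ν : Measure (Fin p → ℝ)) : Prop :=
  IsProbabilityMeasure ν ∧
  (∀ j, Integrable (fun w => w j) ν ∧ (∫ w, w j ∂ν) = 0) ∧
  ∀ v : Fin p → ℝ, sqnorm p v = 1 →
    (∫⁻ w, ENNReal.ofReal (|∑ j, w j * v j| ^ α) ∂ν) ≤ 1

/-- The class `𝒲_α^⊗`: independent columns with distributions in `𝒲_α`. -/
def Wclass (p n : ℕ) (α : ℝ) : Set (Measure (Fin n → Fin p → ℝ)) :=
  {P | ∃ ν : Fin n → Measure (Fin p → ℝ), (∀ t, memW p α (ν t)) ∧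
    IsProbabilityMeasure P ∧
    ∀ s : Fin n → Set (Fin p → ℝ), (∀ t, MeasurableSet (s t)) →
      P {x | ∀ t, x t ∈ s t} = ∏ t, ν t (s t)}

/-- The alternative `⋃_{t₀=1}^{n−1} Θ(p,n,ρ_{t₀})` for a location-dependent signal
strength sequence `ρ`. -/
def ThetaSeq (p n : ℕ) (ρ : ℕ → ℝ) : Set (Fin n → Fin p → ℝ) :=
  ⋃ t0 ∈ Finset.Icc 1 (n - 1),
    {θ | ∃ μ₁ μ₂ : Fin p → ℝ,
      (∀ t : Fin n, (t : ℕ) < t0 → θ t = μ₁) ∧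
      (∀ t : Fin n, t0 ≤ (t : ℕ) → θ t = μ₂) ∧
      (ρ t0) ^ 2 ≤ sqnorm p (fun j => μ₁ j - μ₂ j)}

/-- The boundary-restricted alternative `Θ_res(p,n,s,ρ)`. -/
def ThetaRes (p n s : ℕ) (ρ tres : ℝ) : Set (Fin n → Fin p → ℝ) :=
  {θ | ∃ t0 : ℕ, tres + 1 ≤ (t0 : ℝ) ∧ (t0 : ℝ) ≤ (n : ℝ) - tres ∧ θ ∈ ThetaAt p n t0 s ρ}

/-- `t^res = 32 (log (e² p / s) + s^{−1} log log (8n))`. -/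
def tRes (p n s : ℕ) : ℝ :=
  32 * (Real.log (Real.exp 1 ^ 2 * (p : ℝ) / (s : ℝ)) + LL n / (s : ℝ))

end

open ProbabilityTheory

section Independence

variable {Ω : Type*} [MeasurableSpace Ω] {P : Measure Ω}

/-- Tuples of independent random variables indexed by disjoint blocks are independent. -/
theorem iIndepFun_blocks {ι κ : Type*} {f : ι → Ω → ℝ} (hf : iIndepFun f P)
    (hm : ∀ i, Measurable (f i)) (S : κ → Finset ι) (hS : Pairwise fun k l => Disjoint (S k) (S l)) :
    iIndepFun (fun k ω (i : S k) => f i ω) P := by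
  rw [iIndepFun_iff_measure_inter_preimage_eq_mul]
  intro T A
  induction T using Finset.induction_on with
  | empty =>
    intro _
    have := hf.isProbabilityMeasure
    simp
  | insert k T hk ih =>
    intro hA
    rw [Finset.set_biInter_insert, Finset.prod_insert hk,
      ← ih fun i hi => hA i (Finset.mem_insert_of_mem hi)]
    have hd : Disjoint (S k) (T.biUnion S) := by
      rw [Finset.disjoint_biUnion_right]
      exact fun l hl => hS fun h => hk (h ▸ hl)
    have hI := hf.indepFun_finset (S k) (T.biUnion S) hd hm
    let B : Set (T.biUnion S → ℝ) := ⋂ l : T,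
      (fun (x : T.biUnion S → ℝ) (i : S l.1) =>
        x ⟨i.1, Finset.mem_biUnion.2 ⟨l.1, l.2, i.2⟩⟩) ⁻¹' A l.1
    have hB : MeasurableSet B := by
      refine MeasurableSet.iInter fun l => ?_
      refine measurableSet_preimage ?_ (hA l.1 (Finset.mem_insert_of_mem l.2))
      exact measurable_pi_lambda _ fun i => measurable_pi_apply _
    have hE : (⋂ l ∈ T, (fun ω (i : S l) => f i ω) ⁻¹' A l) =
        (fun ω (i : T.biUnion S) => f i ω) ⁻¹' B := by
      ext ω
      simp [B]
    rw [hE]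
    exact hI.measure_inter_preimage_eq_mul _ _ (hA k (Finset.mem_insert_self _ _)) hB

/-- If each of `G` events has probability at most `q`, then at least half of them occur
simultaneously with probability at most `2 q`. -/
theorem measureReal_majority_le [IsProbabilityMeasure P] {G : ℕ} (hG : 0 < G) {B : Fin G → Set Ω}
    (hB : ∀ g, MeasurableSet (B g)) {q : ℝ} (hq : ∀ g, P.real (B g) ≤ q) :
    P.real {ω | G ≤ 2 * (Finset.univ.filter fun g => ω ∈ B g).card} ≤ 2 * q := by
  have hcard : ∀ ω, (((Finset.univ.filter fun g => ω ∈ B g).card : ℕ) : ℝ) =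
      ∑ g, (B g).indicator (fun _ => (1 : ℝ)) ω := by
    intro ω
    simp [Set.indicator_apply]
  have hintegral : ∀ g, Integrable ((B g).indicator fun _ => (1 : ℝ)) P := fun g =>
    (integrable_const 1).indicator (hB g)
  have h := mul_meas_ge_le_integral_of_nonneg (μ := P)
    (f := fun ω => ∑ g, (B g).indicator (fun _ => (1 : ℝ)) ω)
    (Filter.Eventually.of_forall fun ω => Finset.sum_nonneg fun g _ =>
      Set.indicator_nonneg (fun _ _ => zero_le_one) _)
    (integrable_finsetSum _ fun g _ => hintegral g) ((G : ℝ) / 2)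
  rw [integral_finsetSum _ fun g _ => hintegral g] at h
  have hsum : ∑ g, ∫ ω, (B g).indicator (fun _ => (1 : ℝ)) ω ∂P ≤ G * q := by
    calc ∑ g, ∫ ω, (B g).indicator (fun _ => (1 : ℝ)) ω ∂P ≤ ∑ _g : Fin G, q := by
          refine Finset.sum_le_sum fun g _ => ?_
          rw [integral_indicator_const _ (hB g)]
          simpa using hq g
      _ = G * q := by simp
  have hset : {ω | G ≤ 2 * (Finset.univ.filter fun g => ω ∈ B g).card} =
      {ω | (G : ℝ) / 2 ≤ ∑ g, (B g).indicator (fun _ => (1 : ℝ)) ω} := by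
    ext ω
    rw [Set.mem_ofPred_eq, Set.mem_ofPred_eq, ← hcard, div_le_iff₀ two_pos]
    rw [mul_comm, ← @Nat.cast_le ℝ]
    push_cast
    rfl
  rw [hset]
  have hG' : (0 : ℝ) < G := by exact_mod_cast hG
  have := h.trans hsum
  nlinarith

/-- If `G` independent events have probability at most `q` each, then at least half of them occur
simultaneously with probability at most `(2 √q)^G`. -/
theorem measureReal_majority_le_pow {G : ℕ} {B : Fin G → Set Ω} (hI : iIndepSet B P)
    {q : ℝ} (hq1 : q ≤ 1) (hq : ∀ g, P.real (B g) ≤ q) :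
    P.real {ω | G ≤ 2 * (Finset.univ.filter fun g => ω ∈ B g).card} ≤ (2 * √q) ^ G := by
  have hP : IsProbabilityMeasure P := hI.isProbabilityMeasure
  rcases Nat.eq_zero_or_pos G with rfl | hG
  · simp
  have hq0 : 0 ≤ q := measureReal_nonneg.trans (hq ⟨0, hG⟩)
  let F : Finset (Finset (Fin G)) := Finset.univ.filter fun T => G ≤ 2 * T.card
  have hsub : {ω | G ≤ 2 * (Finset.univ.filter fun g => ω ∈ B g).card} ⊆
      ⋃ T ∈ F, ⋂ g ∈ T, B g := by
    intro ω hω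
    simp only [Set.mem_iUnion]
    exact ⟨Finset.univ.filter fun g => ω ∈ B g, by simpa [F] using hω, by simp⟩
  have hone : ∀ T ∈ F, P.real (⋂ g ∈ T, B g) ≤ (√q) ^ G := by
    intro T hT
    have hT' : G ≤ 2 * T.card := by simpa [F] using hT
    rw [measureReal_def, hI.meas_biInter, ENNReal.toReal_prod]
    calc ∏ g ∈ T, (P (B g)).toReal ≤ ∏ _g ∈ T, q :=
          Finset.prod_le_prod (fun _ _ => ENNReal.toReal_nonneg) fun g _ => hq g
      _ = (√q) ^ (2 * T.card) := by rw [Finset.prod_const, pow_mul, Real.sq_sqrt hq0]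
      _ ≤ (√q) ^ G := pow_le_pow_of_le_one (Real.sqrt_nonneg _) (Real.sqrt_le_one.2 hq1) hT'
  calc P.real {ω | G ≤ 2 * (Finset.univ.filter fun g => ω ∈ B g).card}
      ≤ P.real (⋃ T ∈ F, ⋂ g ∈ T, B g) := measureReal_mono hsub (measure_ne_top _ _)
    _ ≤ ∑ T ∈ F, P.real (⋂ g ∈ T, B g) := measureReal_biUnion_finset_le _ _
    _ ≤ ∑ _T ∈ F, (√q) ^ G := Finset.sum_le_sum hone
    _ = F.card * (√q) ^ G := by rw [Finset.sum_const, nsmul_eq_mul]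
    _ ≤ 2 ^ G * (√q) ^ G := by
        gcongr
        have : F.card ≤ (Finset.univ : Finset (Finset (Fin G))).card := Finset.card_filter_le _ _
        rw [Finset.card_univ, Fintype.card_finset, Fintype.card_fin] at this
        exact_mod_cast this
    _ = (2 * √q) ^ G := (mul_pow _ _ _).symm

end Independence

section Noise

variable {Ω : Type*} [MeasurableSpace Ω] {P : Measure Ω}

theorem integrable_pow_of_memLp_four [IsFiniteMeasure P] {X : Ω → ℝ} (hX : MemLp X 4 P) {k : ℕ}
    (hk : k ≤ 4) : Integrable (fun ω => X ω ^ k) P := by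
  have h : MemLp X (k : ENNReal) P := hX.mono_exponent (by exact_mod_cast hk)
  refine (integrable_norm_iff (hX.1.pow k)).1 ?_
  simpa [norm_pow] using h.integrable_norm_pow'

theorem integral_add_pow_two_of_indepFun [IsProbabilityMeasure P] {X Y : Ω → ℝ}
    (hI : IndepFun X Y P) (hX : MemLp X 4 P) (hY : MemLp Y 4 P) (hX0 : ∫ ω, X ω ∂P = 0) :
    ∫ ω, (X ω + Y ω) ^ 2 ∂P = ∫ ω, X ω ^ 2 ∂P + ∫ ω, Y ω ^ 2 ∂P := by
  have iX2 := integrable_pow_of_memLp_four hX (k := 2) (by norm_num)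
  have iY2 := integrable_pow_of_memLp_four hY (k := 2) (by norm_num)
  have iX1 : Integrable X P := by
    simpa using integrable_pow_of_memLp_four hX (k := 1) (by norm_num)
  have iY1 : Integrable Y P := by
    simpa using integrable_pow_of_memLp_four hY (k := 1) (by norm_num)
  have iXY : Integrable (fun ω => X ω * Y ω) P := hI.integrable_mul iX1 iY1
  have hXY : ∫ ω, X ω * Y ω ∂P = (∫ ω, X ω ∂P) * ∫ ω, Y ω ∂P :=
    hI.integral_fun_mul_eq_mul_integral hX.1 hY.1
  calc ∫ ω, (X ω + Y ω) ^ 2 ∂P = ∫ ω, (X ω ^ 2 + 2 * (X ω * Y ω)) + Y ω ^ 2 ∂P := by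
        congr 1; ext ω; ring
    _ = _ := by
        have h : Integrable (fun ω => X ω ^ 2 + 2 * (X ω * Y ω)) P := iX2.add (iXY.const_mul 2)
        rw [integral_add h iY2, integral_add iX2 (iXY.const_mul 2),
          integral_const_mul, hXY, hX0]
        ring

theorem integral_add_pow_four_of_indepFun [IsProbabilityMeasure P] {X Y : Ω → ℝ}
    (hI : IndepFun X Y P) (hX : MemLp X 4 P) (hY : MemLp Y 4 P) (hX0 : ∫ ω, X ω ∂P = 0)
    (hY0 : ∫ ω, Y ω ∂P = 0) :
    ∫ ω, (X ω + Y ω) ^ 4 ∂P =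
      ∫ ω, X ω ^ 4 ∂P + 6 * ((∫ ω, X ω ^ 2 ∂P) * ∫ ω, Y ω ^ 2 ∂P) + ∫ ω, Y ω ^ 4 ∂P := by
  have iX := fun k (hk : k ≤ 4) => integrable_pow_of_memLp_four hX hk
  have iY := fun k (hk : k ≤ 4) => integrable_pow_of_memLp_four hY hk
  have hJ : ∀ k l : ℕ, IndepFun (fun ω => X ω ^ k) (fun ω => Y ω ^ l) P := fun k l =>
    hI.comp (measurable_id.pow_const k) (measurable_id.pow_const l)
  have iXY : ∀ k l : ℕ, k ≤ 4 → l ≤ 4 → Integrable (fun ω => X ω ^ k * Y ω ^ l) P :=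
    fun k l hk hl => (hJ k l).integrable_mul (iX k hk) (iY l hl)
  have eXY : ∀ k l : ℕ, ∫ ω, X ω ^ k * Y ω ^ l ∂P = (∫ ω, X ω ^ k ∂P) * ∫ ω, Y ω ^ l ∂P :=
    fun k l => (hJ k l).integral_fun_mul_eq_mul_integral (hX.1.pow k) (hY.1.pow l)
  have e1 := eXY 3 1
  have e2 := eXY 2 2
  have e3 := eXY 1 3
  simp only [pow_one, hX0, hY0, zero_mul, mul_zero] at e1 e3
  have j1 := (iXY 3 1 (by norm_num) (by norm_num)).const_mul 4
  have j2 := (iXY 2 2 (by norm_num) (by norm_num)).const_mul 6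
  have j3 := (iXY 1 3 (by norm_num) (by norm_num)).const_mul 4
  simp only [pow_one] at j1 j3
  calc ∫ ω, (X ω + Y ω) ^ 4 ∂P = ∫ ω, (((X ω ^ 4 + 4 * (X ω ^ 3 * Y ω)) +
        6 * (X ω ^ 2 * Y ω ^ 2)) + 4 * (X ω * Y ω ^ 3)) + Y ω ^ 4 ∂P := by
        congr 1; ext ω; ring
    _ = _ := by
        have h1 : Integrable (fun ω => X ω ^ 4 + 4 * (X ω ^ 3 * Y ω)) P := (iX 4 le_rfl).add j1
        have h2 : Integrable (fun ω => X ω ^ 4 + 4 * (X ω ^ 3 * Y ω) +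
            6 * (X ω ^ 2 * Y ω ^ 2)) P := h1.add j2
        have h3 : Integrable (fun ω => X ω ^ 4 + 4 * (X ω ^ 3 * Y ω) +
            6 * (X ω ^ 2 * Y ω ^ 2) + 4 * (X ω * Y ω ^ 3)) P := h2.add j3
        rw [integral_add h3 (iY 4 le_rfl), integral_add h2 j3, integral_add h1 j2, integral_add (iX 4 le_rfl) j1,
          integral_const_mul, integral_const_mul, integral_const_mul, e1, e2, e3]
        ring

/-- A family of independent, centred, unit-variance variables with fourth moments at most `κ`. -/
structure IsNoise {ι : Type*} (P : Measure Ω) (f : ι → Ω → ℝ) (κ : ℝ) : Prop where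
  indep : iIndepFun f P
  meas : ∀ i, Measurable (f i)
  memLp : ∀ i, MemLp (f i) 4 P
  mean : ∀ i, ∫ ω, f i ω ∂P = 0
  var : ∀ i, ∫ ω, f i ω ^ 2 ∂P = 1
  fourth : ∀ i, ∫ ω, f i ω ^ 4 ∂P ≤ κ

namespace IsNoise

variable {ι : Type*} {f : ι → Ω → ℝ} {κ : ℝ}

theorem memLp_sum (hf : IsNoise P f κ) (S : Finset ι) (a : ι → ℝ) :
    MemLp (fun ω => ∑ i ∈ S, a i * f i ω) 4 P :=
  memLp_finsetSum S fun i _ => (hf.memLp i).const_mul (a i)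

theorem moments_sum (hf : IsNoise P f κ) (S : Finset ι) (a : ι → ℝ) :
    ∫ ω, ∑ i ∈ S, a i * f i ω ∂P = 0 ∧
    ∫ ω, (∑ i ∈ S, a i * f i ω) ^ 2 ∂P = ∑ i ∈ S, a i ^ 2 ∧
    ∫ ω, (∑ i ∈ S, a i * f i ω) ^ 4 ∂P ≤ 3 * (∑ i ∈ S, a i ^ 2) ^ 2 + κ * ∑ i ∈ S, a i ^ 4 := by
  have hP : IsProbabilityMeasure P := hf.indep.isProbabilityMeasure
  induction S using Finset.induction_on with
  | empty => simp
  | insert k S hk ih =>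
    obtain ⟨h1, h2, h4⟩ := ih
    have hX : MemLp (fun ω => a k * f k ω) 4 P := (hf.memLp k).const_mul (a k)
    have hY := hf.memLp_sum S a
    have hI : IndepFun (fun ω => a k * f k ω) (fun ω => ∑ i ∈ S, a i * f i ω) P := by
      have hg : iIndepFun (fun i ω => a i * f i ω) P :=
        hf.indep.comp (fun i x => a i * x) fun i => measurable_const_mul (a i)
      have := hg.indepFun_finsetSum_of_notMem (fun i => (hf.meas i).const_mul (a i)) hk
      convert this.symm using 1
      ext ω
      simp
    have hX0 : ∫ ω, a k * f k ω ∂P = 0 := by rw [integral_const_mul, hf.mean, mul_zero]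
    have hX2 : ∫ ω, (a k * f k ω) ^ 2 ∂P = a k ^ 2 := by
      simp_rw [mul_pow]
      rw [integral_const_mul, hf.var, mul_one]
    have hX4 : ∫ ω, (a k * f k ω) ^ 4 ∂P ≤ a k ^ 4 * κ := by
      simp_rw [mul_pow]
      rw [integral_const_mul]
      exact mul_le_mul_of_nonneg_left (hf.fourth k) (by positivity)
    simp_rw [Finset.sum_insert hk]
    refine ⟨?_, ?_, ?_⟩
    · rw [integral_add (hX.integrable (by norm_num)) (hY.integrable (by norm_num)), hX0, h1,
        add_zero]
    · rw [integral_add_pow_two_of_indepFun hI hX hY hX0, hX2, h2]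
    · rw [integral_add_pow_four_of_indepFun hI hX hY hX0 h1, hX2, h2]
      nlinarith [sq_nonneg (a k ^ 2)]

/-- Normalised linear combinations over disjoint blocks are again noise. -/
theorem blocks (hf : IsNoise P f κ) (hκ : 0 ≤ κ) {τ : Type*} (S : τ → Finset ι)
    (hS : Pairwise fun k l => Disjoint (S k) (S l)) (a : τ → ι → ℝ)
    (ha : ∀ k, ∑ i ∈ S k, a k i ^ 2 = 1) :
    IsNoise P (fun k ω => ∑ i ∈ S k, a k i * f i ω) (3 + κ) where
  indep := by
    have h := (iIndepFun_blocks hf.indep hf.meas S hS).comp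
      (fun k x => ∑ i : S k, a k i * x i) fun k =>
        Finset.measurable_sum _ fun i _ => (measurable_pi_apply i).const_mul _
    convert h using 3 with k ω
    exact (Finset.sum_coe_sort (S k) fun i => a k i * f i ω).symm
  meas k := Finset.measurable_sum _ fun i _ => (hf.meas i).const_mul _
  memLp k := hf.memLp_sum _ _
  mean k := (hf.moments_sum _ _).1
  var k := by rw [(hf.moments_sum _ _).2.1, ha]
  fourth k := by
    refine (hf.moments_sum _ _).2.2.trans ?_
    have h4 : ∑ i ∈ S k, a k i ^ 4 ≤ 1 := by
      calc ∑ i ∈ S k, a k i ^ 4 ≤ ∑ i ∈ S k, a k i ^ 2 := by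
            refine Finset.sum_le_sum fun i hi => ?_
            have h1 : a k i ^ 2 ≤ 1 :=
              (Finset.single_le_sum (fun j _ => sq_nonneg (a k j)) hi).trans (ha k).le
            nlinarith [sq_nonneg (a k i)]
        _ = 1 := ha k
    rw [ha]
    nlinarith

theorem measureReal_abs_sum_ge_le (hf : IsNoise P f κ) (S : Finset ι) (a : ι → ℝ) {x : ℝ}
    (hx : 0 < x) :
    P.real {ω | x ≤ |∑ i ∈ S, a i * f i ω|} ≤ (∑ i ∈ S, a i ^ 2) / x ^ 2 := by
  have hP : IsProbabilityMeasure P := hf.indep.isProbabilityMeasure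
  have h := mul_meas_ge_le_integral_of_nonneg (μ := P) (f := fun ω => (∑ i ∈ S, a i * f i ω) ^ 2)
    (Filter.Eventually.of_forall fun ω => sq_nonneg _)
    (integrable_pow_of_memLp_four (hf.memLp_sum S a) (by norm_num)) (x ^ 2)
  rw [(hf.moments_sum S a).2.1] at h
  rw [le_div_iff₀ (by positivity), mul_comm]
  have hset : {ω | x ≤ |∑ i ∈ S, a i * f i ω|} = {ω | x ^ 2 ≤ (∑ i ∈ S, a i * f i ω) ^ 2} := by
    ext ω
    simp only [Set.mem_ofPred_eq]
    rw [← sq_abs (∑ i ∈ S, a i * f i ω)]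
    exact (pow_le_pow_iff_left₀ hx.le (abs_nonneg _) two_ne_zero).symm
  rwa [hset]

theorem measureReal_abs_sum_sq_sub_one_ge_le (hf : IsNoise P f κ) (S : Finset ι) {x : ℝ}
    (hx : 0 < x) :
    P.real {ω | x ≤ |∑ i ∈ S, (f i ω ^ 2 - 1)|} ≤ S.card * κ / x ^ 2 := by
  have hP : IsProbabilityMeasure P := hf.indep.isProbabilityMeasure
  have hi2 : ∀ i, Integrable (fun ω => f i ω ^ 2) P := fun i =>
    integrable_pow_of_memLp_four (hf.memLp i) (by norm_num)
  have hi4 : ∀ i, Integrable (fun ω => f i ω ^ 4) P := fun i =>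
    integrable_pow_of_memLp_four (hf.memLp i) le_rfl
  have hm : ∀ i, MemLp (fun ω => f i ω ^ 2 - 1) 2 P := by
    intro i
    have : MemLp (fun ω => f i ω ^ 2) 2 P := by
      rw [memLp_two_iff_integrable_sq ((hf.meas i).pow_const 2).aestronglyMeasurable]
      simpa [← pow_mul] using hi4 i
    exact this.sub (memLp_const 1)
  have hmean : ∀ i, ∫ ω, (f i ω ^ 2 - 1) ∂P = 0 := by
    intro i
    rw [integral_sub (hi2 i) (integrable_const 1), hf.var]
    simp
  have hvar : ∀ i, Var[fun ω => f i ω ^ 2 - 1; P] ≤ κ := by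
    intro i
    rw [variance_eq_integral (hm i).1.aemeasurable, hmean]
    simp only [sub_zero]
    have : ∫ ω, (f i ω ^ 2 - 1) ^ 2 ∂P = ∫ ω, f i ω ^ 4 ∂P - 1 := by
      calc ∫ ω, (f i ω ^ 2 - 1) ^ 2 ∂P = ∫ ω, (f i ω ^ 4 - 2 * f i ω ^ 2) + 1 ∂P := by
            congr 1; ext ω; ring
        _ = _ := by
            have h : Integrable (fun ω => f i ω ^ 4 - 2 * f i ω ^ 2) P :=
              (hi4 i).sub ((hi2 i).const_mul 2)
            rw [integral_add h (integrable_const 1),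
              integral_sub (hi4 i) ((hi2 i).const_mul 2), integral_const_mul, hf.var]
            simp
            ring
    linarith [hf.fourth i]
  have hI : iIndepFun (fun i ω => f i ω ^ 2 - 1) P :=
    hf.indep.comp (fun _ x => x ^ 2 - 1) fun _ => (measurable_id.pow_const 2).sub_const 1
  have hV := IndepFun.variance_sum (μ := P) (X := fun i ω => f i ω ^ 2 - 1) (s := S)
    (fun i _ => hm i) fun i _ j _ hij => hI.indepFun hij
  have hfun : (∑ i ∈ S, fun ω => f i ω ^ 2 - 1) = fun ω => ∑ i ∈ S, (f i ω ^ 2 - 1) := by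
    ext ω
    simp
  rw [hfun] at hV
  have hmean' : ∫ ω, ∑ i ∈ S, (f i ω ^ 2 - 1) ∂P = 0 := by
    rw [integral_finsetSum S fun i _ => (hm i).integrable one_le_two]
    exact Finset.sum_eq_zero fun i _ => hmean i
  have h := meas_ge_le_variance_div_sq (memLp_finsetSum S fun i _ => hm i) hx
  rw [hmean', hV] at h
  simp only [sub_zero] at h
  have hle : (∑ i ∈ S, Var[fun ω => f i ω ^ 2 - 1; P]) / x ^ 2 ≤ S.card * κ / x ^ 2 := by
    gcongr
    calc ∑ i ∈ S, Var[fun ω => f i ω ^ 2 - 1; P] ≤ ∑ _i ∈ S, κ :=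
          Finset.sum_le_sum fun i _ => hvar i
      _ = S.card * κ := by simp
  refine le_trans ?_ hle
  rw [measureReal_def]
  exact ENNReal.toReal_le_of_le_ofReal
    (div_nonneg (Finset.sum_nonneg fun i _ => variance_nonneg _ _) (sq_nonneg _)) h

end IsNoise

end Noise

section Subtests

/-- Strict or non-strict majority of the groups satisfies `Q`. -/
def Majority {G : ℕ} (Q : Fin G → Prop) : Prop :=
  G ≤ 2 * (Finset.univ.filter fun g => Q g).card

/-- Rejection rule of the dense subtest: most group statistics `∑ⱼ (y² - 1)` exceed `x`. -/
def RejDense {G p : ℕ} (x : ℝ) (y : Fin G → Fin p → ℝ) : Prop :=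
  Majority fun g => x < ∑ j, (y g j ^ 2 - 1)

/-- Rejection rule of the directional subtest: most projections on `z` exceed `x`. -/
def RejDir {G p : ℕ} (x : ℝ) (z : Fin p → ℤ) (y : Fin G → Fin p → ℝ) : Prop :=
  Majority fun g => x < ∑ j, (z j : ℝ) * y g j

/-- Rejection rule of the coordinatewise subtest: some coordinate exceeds `b` in all groups. -/
def RejCoord {G p : ℕ} (b : ℝ) (y : Fin G → Fin p → ℝ) : Prop :=
  ∃ j, ∀ g, b < |y g j|

/-- Rejection rule of the `ℓ_α` subtest. -/
def RejPow {p : ℕ} (α x : ℝ) (y : Fin p → ℝ) : Prop := x < ∑ j, |y j| ^ α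

theorem Majority.not {G : ℕ} {Q : Fin G → Prop} (h : ¬ Majority Q) : Majority fun g => ¬ Q g := by
  have h1 := Finset.card_filter_add_card_filter_not (s := (Finset.univ : Finset (Fin G))) Q
  have h2 : 2 * (Finset.univ.filter Q).card < G := not_le.1 h
  rw [Finset.card_univ, Fintype.card_fin] at h1
  have h3 : G ≤ 2 * (Finset.univ.filter fun g => ¬ Q g).card := by omega
  unfold Majority
  convert h3

variable {Ω : Type*} [MeasurableSpace Ω] {P : Measure Ω}

theorem measureReal_mono_pred [IsFiniteMeasure P] {Q R : Ω → Prop} (h : ∀ ω, Q ω → R ω) :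
    P.real {ω | Q ω} ≤ P.real {ω | R ω} :=
  measureReal_mono (fun ω hω => h ω hω) (measure_ne_top _ _)

theorem measurableSet_majority {G : ℕ} {Q : Fin G → Ω → Prop}
    (hQ : ∀ g, MeasurableSet {ω | Q g ω}) : MeasurableSet {ω | Majority fun g => Q g ω} := by
  unfold Majority
  have : {ω | G ≤ 2 * (Finset.univ.filter fun g => Q g ω).card} =
      ⋃ T ∈ (Finset.univ.filter fun T : Finset (Fin G) => G ≤ 2 * T.card),
        ⋂ g ∈ T, {ω | Q g ω} := by
    ext ω
    simp only [Set.mem_ofPred_eq, Set.mem_iUnion, Set.mem_iInter, Finset.mem_filter,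
      Finset.mem_univ, true_and, exists_prop]
    constructor
    · intro h
      exact ⟨_, h, fun g hg => (Finset.mem_filter.1 hg).2⟩
    · rintro ⟨T, hT, h⟩
      refine hT.trans (Nat.mul_le_mul_left _ (Finset.card_le_card fun g hg => ?_))
      simpa using h g hg
  rw [this]
  exact Finset.measurableSet_biUnion _ fun T _ => Finset.measurableSet_biInter _ fun g _ => hQ g

namespace IsNoise

theorem measureReal_abs_ge_le {ι : Type*} {f : ι → Ω → ℝ} {κ : ℝ} (hf : IsNoise P f κ) (i : ι)
    {x : ℝ} (hx : 0 < x) : P.real {ω | x ≤ |f i ω|} ≤ 1 / x ^ 2 := by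
  have := hf.measureReal_abs_sum_ge_le {i} (fun _ => 1) hx
  simpa using this

variable {G p : ℕ} {U : Fin G × Fin p → Ω → ℝ} {κ : ℝ}

theorem iIndepSet_rows (hU : IsNoise P U κ) {A : Fin G → Set (Fin p → ℝ)}
    (hA : ∀ g, MeasurableSet (A g)) :
    iIndepSet (fun g => {ω | (fun j => U (g, j) ω) ∈ A g}) P := by
  have h := iIndepFun_blocks hU.indep hU.meas
    (fun g : Fin G => Finset.univ.filter fun i : Fin G × Fin p => i.1 = g) (by
      intro k l hkl
      rw [Finset.disjoint_filter]
      rintro i - rfl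
      exact hkl)
  have h2 : iIndepFun (fun g ω j => U (g, j) ω) P := by
    refine h.comp (fun g x j => x ⟨(g, j), by simp⟩) fun g => ?_
    exact measurable_pi_lambda _ fun j => measurable_pi_apply _
  have hm : ∀ g, MeasurableSet {ω | (fun j => U (g, j) ω) ∈ A g} := fun g =>
    measurableSet_preimage (measurable_pi_lambda _ fun j => hU.meas _) (hA g)
  rw [iIndepSet_iff_meas_biInter hm]
  intro T
  exact (iIndepFun_iff_measure_inter_preimage_eq_mul.1 h2) T (fun g _ => hA g)

theorem dense_null_group (hU : IsNoise P U κ) {c q : ℝ} (hc : 0 < c) (hcq : κ / c ^ 2 ≤ q)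
    (hp : 0 < p) (g : Fin G) :
    P.real {ω | c * √p < ∑ j, (U (g, j) ω ^ 2 - 1)} ≤ q := by
  have hP : IsProbabilityMeasure P := hU.indep.isProbabilityMeasure
  have hp' : (0 : ℝ) < p := by exact_mod_cast hp
  have h := hU.measureReal_abs_sum_sq_sub_one_ge_le
    (Finset.univ.map ⟨fun j => (g, j), Prod.mk_right_injective g⟩) (x := c * √p) (by positivity)
  simp only [Finset.sum_map, Function.Embedding.coeFn_mk, Finset.card_map, Finset.card_univ,
    Fintype.card_fin] at h
  calc _ ≤ P.real {ω | c * √p ≤ |∑ j, (U (g, j) ω ^ 2 - 1)|} :=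
        measureReal_mono_pred fun ω hω => hω.le.trans (le_abs_self _)
    _ ≤ _ := h
    _ = κ / c ^ 2 := by
        rw [mul_pow, Real.sq_sqrt hp'.le]
        field_simp
    _ ≤ q := hcq

theorem dense_null (hU : IsNoise P U κ) {c q : ℝ} (hc : 0 < c) (hcq : κ / c ^ 2 ≤ q)
    (hq1 : q ≤ 1) (hp : 0 < p) :
    P.real {ω | RejDense (c * √p) fun g j => U (g, j) ω} ≤ (2 * √q) ^ G := by
  have hI := hU.iIndepSet_rows (A := fun _ => {y | c * √p < ∑ j, (y j ^ 2 - 1)}) fun g =>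
    measurableSet_lt measurable_const <|
      Finset.measurable_sum _ fun j _ => ((measurable_pi_apply j).pow_const 2).sub_const 1
  exact measureReal_majority_le_pow hI hq1 fun g => hU.dense_null_group hc hcq hp g

theorem dense_null_two_mul (hU : IsNoise P U κ) {c q : ℝ} (hc : 0 < c) (hcq : κ / c ^ 2 ≤ q)
    (hp : 0 < p) (hG : 0 < G) :
    P.real {ω | RejDense (c * √p) fun g j => U (g, j) ω} ≤ 2 * q := by
  have hP : IsProbabilityMeasure P := hU.indep.isProbabilityMeasure
  exact measureReal_majority_le hG (B := fun g => {ω | c * √p < ∑ j, (U (g, j) ω ^ 2 - 1)})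
    (fun g => measurableSet_lt measurable_const <|
      Finset.measurable_sum _ fun j _ => ((hU.meas _).pow_const 2).sub_const 1)
    fun g => hU.dense_null_group hc hcq hp g

theorem dense_power (hU : IsNoise P U κ) {c q : ℝ} (hc : 0 < c) (hcq : κ / c ^ 2 + 4 / c ≤ q)
    (hp : 0 < p) (hG : 0 < G) (h : Fin p → ℝ) (hh : 4 * c * √p ≤ ∑ j, h j ^ 2) :
    P.real {ω | ¬ RejDense (c * √p) fun g j => h j + U (g, j) ω} ≤ 2 * q := by
  have hP : IsProbabilityMeasure P := hU.indep.isProbabilityMeasure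
  have hp' : (1 : ℝ) ≤ p := by exact_mod_cast hp
  have hsp : 1 ≤ √(p : ℝ) := Real.one_le_sqrt.2 hp'
  set H := ∑ j, h j ^ 2 with hH
  have hH4 : 4 * c ≤ H := le_trans (by nlinarith) hh
  have hHpos : 0 < H := by linarith
  calc _ ≤ P.real {ω | Majority fun g => ω ∈ {ω | ¬ c * √p < ∑ j, ((h j + U (g, j) ω) ^ 2 - 1)}} :=
        measureReal_mono (fun ω hω => Majority.not hω) (measure_ne_top _ _)
    _ ≤ 2 * q := by
        refine measureReal_majority_le hG (fun g => ?_) fun g => ?_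
        · exact (measurableSet_lt measurable_const <| Finset.measurable_sum _ fun j _ =>
            (((hU.meas _).const_add (h j)).pow_const 2).sub_const 1).compl
        have h1 := hU.measureReal_abs_sum_sq_sub_one_ge_le
          (Finset.univ.map ⟨fun j => (g, j), Prod.mk_right_injective g⟩) (x := c * √p)
          (by positivity)
        have h2 := hU.measureReal_abs_sum_ge_le
          (Finset.univ.map ⟨fun j => (g, j), Prod.mk_right_injective g⟩) (fun i => h i.2)
          (x := H / 4) (by positivity)
        simp only [Finset.sum_map, Function.Embedding.coeFn_mk, Finset.card_map, Finset.card_univ,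
          Fintype.card_fin, ← hH] at h1 h2
        calc _ ≤ P.real ({ω | c * √p ≤ |∑ j, (U (g, j) ω ^ 2 - 1)|} ∪
              {ω | H / 4 ≤ |∑ j, h j * U (g, j) ω|}) := by
              refine measureReal_mono (fun ω hω => ?_) (measure_ne_top _ _)
              simp only [Set.mem_ofPred_eq, not_lt, Set.mem_union] at hω ⊢
              by_contra! hcon
              have e : ∑ j, ((h j + U (g, j) ω) ^ 2 - 1) =
                  H + 2 * ∑ j, h j * U (g, j) ω + ∑ j, (U (g, j) ω ^ 2 - 1) := by
                rw [hH, Finset.mul_sum, ← Finset.sum_add_distrib, ← Finset.sum_add_distrib]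
                exact Finset.sum_congr rfl fun j _ => by ring
              have a1 := (abs_lt.1 hcon.1).1
              have a2 := (abs_lt.1 hcon.2).1
              rw [e] at hω
              linarith
          _ ≤ _ := measureReal_union_le _ _
          _ ≤ p * κ / (c * √p) ^ 2 + H / (H / 4) ^ 2 := add_le_add h1 h2
          _ = κ / c ^ 2 + 16 / H := by
              rw [mul_pow, Real.sq_sqrt (by linarith)]
              field_simp
              ring
          _ ≤ κ / c ^ 2 + 4 / c := by
              refine add_le_add_right ?_ _
              rw [div_le_div_iff₀ hHpos hc]
              linarith
          _ ≤ q := hcq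

theorem dir_null (hU : IsNoise P U κ) {x q : ℝ} {z : Fin p → ℤ} (hx : 0 < x)
    (hz : (∑ j, (z j : ℝ) ^ 2) / x ^ 2 ≤ q) (hq1 : q ≤ 1) :
    P.real {ω | RejDir x z fun g j => U (g, j) ω} ≤ (2 * √q) ^ G := by
  have hP : IsProbabilityMeasure P := hU.indep.isProbabilityMeasure
  have hI := hU.iIndepSet_rows (A := fun _ => {y | x < ∑ j, (z j : ℝ) * y j}) fun g =>
    measurableSet_lt measurable_const <|
      Finset.measurable_sum _ fun j _ => (measurable_pi_apply j).const_mul _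
  refine measureReal_majority_le_pow hI hq1 fun g => ?_
  have h := hU.measureReal_abs_sum_ge_le
    (Finset.univ.map ⟨fun j => (g, j), Prod.mk_right_injective g⟩) (fun i => (z i.2 : ℝ)) hx
  simp only [Finset.sum_map, Function.Embedding.coeFn_mk] at h
  exact (measureReal_mono_pred fun ω hω => hω.le.trans (le_abs_self _)).trans (h.trans hz)

theorem dir_power (hU : IsNoise P U κ) {x q : ℝ} {z : Fin p → ℤ} (hx : 0 < x)
    (hz : (∑ j, (z j : ℝ) ^ 2) / x ^ 2 ≤ q) (hG : 0 < G) (h : Fin p → ℝ)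
    (hh : 2 * x ≤ ∑ j, (z j : ℝ) * h j) :
    P.real {ω | ¬ RejDir x z fun g j => h j + U (g, j) ω} ≤ 2 * q := by
  have hP : IsProbabilityMeasure P := hU.indep.isProbabilityMeasure
  calc _ ≤ P.real {ω | Majority fun g => ω ∈ {ω | ¬ x < ∑ j, (z j : ℝ) * (h j + U (g, j) ω)}} :=
        measureReal_mono (fun ω hω => Majority.not hω) (measure_ne_top _ _)
    _ ≤ 2 * q := by
        refine measureReal_majority_le hG (fun g => ?_) fun g => ?_
        · exact (measurableSet_lt measurable_const <| Finset.measurable_sum _ fun j _ =>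
            ((hU.meas _).const_add (h j)).const_mul _).compl
        have h2 := hU.measureReal_abs_sum_ge_le
          (Finset.univ.map ⟨fun j => (g, j), Prod.mk_right_injective g⟩) (fun i => (z i.2 : ℝ)) hx
        simp only [Finset.sum_map, Function.Embedding.coeFn_mk] at h2
        refine (measureReal_mono (fun ω hω => ?_) (measure_ne_top _ _)).trans (h2.trans hz)
        simp only [Set.mem_ofPred_eq, not_lt, mul_add, Finset.sum_add_distrib] at hω ⊢
        rw [le_abs]
        right
        linarith

theorem coord_null (hU : IsNoise P U κ) {b : ℝ} (hb : 0 < b) :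
    P.real {ω | RejCoord b fun g j => U (g, j) ω} ≤ p * (1 / b ^ 2) ^ G := by
  have hP : IsProbabilityMeasure P := hU.indep.isProbabilityMeasure
  have hset : {ω | RejCoord b fun g j => U (g, j) ω} =
      ⋃ j ∈ (Finset.univ : Finset (Fin p)), ⋂ g, {ω | b < |U (g, j) ω|} := by
    ext ω
    simp [RejCoord]
  rw [hset]
  refine (measureReal_biUnion_finset_le _ _).trans ?_
  calc ∑ j, P.real (⋂ g, {ω | b < |U (g, j) ω|}) ≤ ∑ _j : Fin p, (1 / b ^ 2) ^ G := by
        refine Finset.sum_le_sum fun j _ => ?_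
        have hI : iIndepFun (fun g => U (g, j)) P :=
          hU.indep.precomp (g := fun g => (g, j)) (Prod.mk_left_injective j)
        have h := iIndepFun_iff_measure_inter_preimage_eq_mul.1 hI Finset.univ
          (sets := fun _ => {x : ℝ | b < |x|})
          fun _ _ => measurableSet_lt measurable_const measurable_norm
        simp only [Finset.mem_univ, Set.iInter_true] at h
        have h' : P.real (⋂ g, {ω | b < |U (g, j) ω|}) = ∏ g, P.real {ω | b < |U (g, j) ω|} := by
          simp only [measureReal_def, ← ENNReal.toReal_prod]
          exact congrArg ENNReal.toReal h
        rw [h']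
        calc _ ≤ ∏ _g : Fin G, (1 / b ^ 2) := by
              refine Finset.prod_le_prod (fun _ _ => measureReal_nonneg) fun g _ => ?_
              exact (measureReal_mono_pred fun ω hω => hω.le).trans
                (hU.measureReal_abs_ge_le (g, j) hb)
          _ = _ := by simp
    _ = p * (1 / b ^ 2) ^ G := by simp

theorem coord_power (hU : IsNoise P U κ) {b : ℝ} (hb : 0 < b) (h : Fin p → ℝ) (j : Fin p)
    (hj : 2 * b ≤ |h j|) :
    P.real {ω | ¬ RejCoord b fun g j => h j + U (g, j) ω} ≤ 4 * G / h j ^ 2 := by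
  have hP : IsProbabilityMeasure P := hU.indep.isProbabilityMeasure
  calc _ ≤ P.real (⋃ g ∈ (Finset.univ : Finset (Fin G)), {ω | |h j| / 2 ≤ |U (g, j) ω|}) := by
        refine measureReal_mono (fun ω hω => ?_) (measure_ne_top _ _)
        simp only [RejCoord, Set.mem_ofPred_eq, not_exists, not_forall, not_lt] at hω
        obtain ⟨g, hg⟩ := hω j
        simp only [Finset.mem_univ, Set.iUnion_true, Set.mem_iUnion, Set.mem_ofPred_eq]
        refine ⟨g, ?_⟩
        have := abs_sub_abs_le_abs_sub (h j) (-U (g, j) ω)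
        rw [sub_neg_eq_add, abs_neg] at this
        linarith
    _ ≤ ∑ g, P.real {ω | |h j| / 2 ≤ |U (g, j) ω|} := measureReal_biUnion_finset_le _ _
    _ ≤ ∑ _g : Fin G, 4 / h j ^ 2 := by
        refine Finset.sum_le_sum fun g _ => ?_
        refine (hU.measureReal_abs_ge_le (g, j) (by linarith)).trans_eq ?_
        rw [div_pow, sq_abs]
        field_simp
        norm_num
    _ = 4 * G / h j ^ 2 := by
        rw [Finset.sum_const, Finset.card_univ, Fintype.card_fin, nsmul_eq_mul]
        ring

end IsNoise

theorem pow_null [IsProbabilityMeasure P] {p : ℕ} {U : Fin p → Ω → ℝ} {α B q : ℝ} (hp : 0 < p)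
    (hB : 0 < B) (hq : 0 < q) (hi : ∀ j, Integrable (fun ω => |U j ω| ^ α) P)
    (hU : ∀ j, ∫ ω, |U j ω| ^ α ∂P ≤ B) :
    P.real {ω | RejPow α (B * p / q) fun j => U j ω} ≤ q := by
  have hp' : (0 : ℝ) < p := by exact_mod_cast hp
  have h := mul_meas_ge_le_integral_of_nonneg (μ := P) (f := fun ω => ∑ j, |U j ω| ^ α)
    (Filter.Eventually.of_forall fun ω => Finset.sum_nonneg fun j _ =>
      Real.rpow_nonneg (abs_nonneg _) _)
    (integrable_finsetSum _ fun j _ => hi j) (B * p / q)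
  rw [integral_finsetSum _ fun j _ => hi j] at h
  have h2 : ∑ j, ∫ ω, |U j ω| ^ α ∂P ≤ B * p := by
    calc _ ≤ ∑ _j : Fin p, B := Finset.sum_le_sum fun j _ => hU j
      _ = B * p := by simp [mul_comm]
  have h3 : P.real {ω | RejPow α (B * p / q) fun j => U j ω} ≤
      P.real {ω | B * p / q ≤ ∑ j, |U j ω| ^ α} :=
    measureReal_mono_pred fun ω hω => LT.lt.le hω
  have h4 : B * p / q * P.real {ω | B * p / q ≤ ∑ j, |U j ω| ^ α} ≤ B * p := h.trans h2
  rw [div_mul_eq_mul_div, div_le_iff₀ hq] at h4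
  exact h3.trans (le_of_mul_le_mul_left h4 (by positivity))

theorem pow_power [IsProbabilityMeasure P] {p : ℕ} {U : Fin p → Ω → ℝ} {α B q : ℝ} (hp : 0 < p)
    (hα : 0 ≤ α) (hB : 0 < B) (hq : 0 < q) (hi : ∀ j, Integrable (fun ω => |U j ω| ^ α) P)
    (hU : ∀ j, ∫ ω, |U j ω| ^ α ∂P ≤ B) (h : Fin p → ℝ)
    (hh : 2 ^ α * (2 * (B * p / q)) < ∑ j, |h j| ^ α) :
    P.real {ω | ¬ RejPow α (B * p / q) fun j => h j + U j ω} ≤ q := by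
  refine (measureReal_mono (fun ω hω => ?_) (measure_ne_top _ _)).trans
    (pow_null hp hB hq hi hU)
  simp only [RejPow, Set.mem_ofPred_eq, not_lt] at hω ⊢
  have key : ∑ j, |h j| ^ α ≤
      2 ^ α * (∑ j, |h j + U j ω| ^ α + ∑ j, |U j ω| ^ α) := by
    rw [← Finset.sum_add_distrib, Finset.mul_sum]
    refine Finset.sum_le_sum fun j _ => ?_
    have h1 : |h j| ≤ 2 * max |h j + U j ω| |U j ω| := by
      have := abs_sub_abs_le_abs_sub (h j) (-U j ω)
      rw [sub_neg_eq_add, abs_neg] at this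
      have a1 := le_max_left |h j + U j ω| |U j ω|
      have a2 := le_max_right |h j + U j ω| |U j ω|
      linarith
    refine (Real.rpow_le_rpow (abs_nonneg _) h1 hα).trans ?_
    rw [Real.mul_rpow zero_le_two (le_max_of_le_left (abs_nonneg _))]
    refine mul_le_mul_of_nonneg_left ?_ (by positivity)
    have n1 : 0 ≤ |h j + U j ω| ^ α := by positivity
    have n2 : 0 ≤ |U j ω| ^ α := by positivity
    rcases max_choice |h j + U j ω| |U j ω| with e | e <;> rw [e] <;> linarith
  have h2 : (0 : ℝ) < 2 ^ α := by positivity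
  have := lt_of_mul_lt_mul_left (hh.trans_le key) h2.le
  linarith

end Subtests

section Entries

theorem memP.integrable_rpow {α K : ℝ} {ν : Measure ℝ} (h : memP α K ν) :
    Integrable (fun x => |x / K| ^ α) ν ∧ ∫ x, |x / K| ^ α ∂ν ≤ 1 := by
  have h5 := h.2.2.2.2
  have hm : AEStronglyMeasurable (fun x : ℝ => |x / K| ^ α) ν :=
    (((measurable_id.div_const K).norm).pow_const α).aestronglyMeasurable
  have hnn : 0 ≤ᵐ[ν] fun x => |x / K| ^ α :=
    Filter.Eventually.of_forall fun x => Real.rpow_nonneg (abs_nonneg _) _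
  refine ⟨(lintegral_ofReal_ne_top_iff_integrable hm hnn).1
    (ne_top_of_le_ne_top ENNReal.one_ne_top h5), ?_⟩
  rw [integral_eq_lintegral_of_nonneg_ae hnn hm]
  exact ENNReal.toReal_le_of_le_ofReal zero_le_one (by simpa using h5)

theorem pow_four_le {α K : ℝ} (hα : 4 ≤ α) (hK : 0 < K) (x : ℝ) :
    x ^ 4 ≤ K ^ 4 * (1 + |x / K| ^ α) := by
  have hx : x ^ 4 = K ^ 4 * |x / K| ^ 4 := by
    rw [← abs_pow, div_pow, abs_of_nonneg (by positivity)]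
    field_simp
  rw [hx]
  refine mul_le_mul_of_nonneg_left ?_ (by positivity)
  rcases le_total |x / K| 1 with h | h
  · have h1 : |x / K| ^ 4 ≤ 1 := pow_le_one₀ (abs_nonneg _) h
    have h2 : 0 ≤ |x / K| ^ α := Real.rpow_nonneg (abs_nonneg _) _
    linarith
  · have := Real.rpow_le_rpow_of_exponent_le h hα
    rw [show (4 : ℝ) = ((4 : ℕ) : ℝ) by norm_num, Real.rpow_natCast] at this
    linarith

theorem memP.integrable_pow_four {α K : ℝ} (hα : 4 ≤ α) (hK : 0 < K) {ν : Measure ℝ}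
    (h : memP α K ν) : Integrable (fun x => x ^ 4) ν ∧ ∫ x, x ^ 4 ∂ν ≤ 2 * K ^ 4 := by
  have hν := h.1
  have hb : Integrable (fun x => K ^ 4 * (1 + |x / K| ^ α)) ν :=
    ((integrable_const 1).add h.integrable_rpow.1).const_mul _
  have hi : Integrable (fun x : ℝ => x ^ 4) ν := by
    refine hb.mono' (measurable_id.pow_const 4).aestronglyMeasurable
      (Filter.Eventually.of_forall fun x => ?_)
    rw [Real.norm_of_nonneg (by positivity)]
    exact pow_four_le hα hK x
  refine ⟨hi, (integral_mono hi hb (pow_four_le hα hK)).trans ?_⟩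
  rw [integral_const_mul, integral_add (integrable_const 1) h.integrable_rpow.1]
  have := h.integrable_rpow.2
  simp only [integral_const, probReal_univ, smul_eq_mul, mul_one]
  nlinarith [pow_pos hK 4]

theorem memP.memLp_four {α K : ℝ} (hα : 4 ≤ α) (hK : 0 < K) {ν : Measure ℝ}
    (h : memP α K ν) : MemLp (fun x => x) 4 ν := by
  have h4 := (h.integrable_pow_four hα hK).1
  have := (integrable_norm_rpow_iff (μ := ν) (f := fun x : ℝ => x) (p := 4)
    measurable_id.aestronglyMeasurable (by norm_num) (by norm_num)).1
  refine this ?_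
  convert h4 using 2 with x
  rw [show (4 : ENNReal).toReal = ((4 : ℕ) : ℝ) by norm_num, Real.rpow_natCast, Real.norm_eq_abs,
    ← abs_pow, abs_of_nonneg (by positivity)]

theorem memP.integral_sq {α K : ℝ} {ν : Measure ℝ} (h : memP α K ν) :
    ∫ x, x ^ 2 ∂ν = 1 := by
  rw [integral_eq_lintegral_of_nonneg_ae (Filter.Eventually.of_forall fun x => sq_nonneg x)
    (measurable_id.pow_const 2).aestronglyMeasurable, h.2.2.2.1]
  simp

variable {p n : ℕ} {P : Measure (Fin n → Fin p → ℝ)} {ν : Fin n → Fin p → Measure ℝ}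

theorem measurable_entry (i : Fin n) (j : Fin p) :
    Measurable fun E : Fin n → Fin p → ℝ => E i j :=
  (measurable_pi_apply j).comp (measurable_pi_apply i)

theorem IsEntrywiseProduct.measure_biInter (h : IsEntrywiseProduct p n P ν)
    (hν : ∀ t j, IsProbabilityMeasure (ν t j)) (S : Finset (Fin n × Fin p))
    {A : Fin n × Fin p → Set ℝ} (hA : ∀ i ∈ S, MeasurableSet (A i)) :
    P (⋂ i ∈ S, (fun E : Fin n → Fin p → ℝ => E i.1 i.2) ⁻¹' A i) =
      ∏ i ∈ S, ν i.1 i.2 (A i) := by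
  have h1 := h.2 (fun t j => if (t, j) ∈ S then A (t, j) else Set.univ) fun t j => by
    split_ifs with hS
    · exact hA _ hS
    · exact MeasurableSet.univ
  have h2 : {x : Fin n → Fin p → ℝ | ∀ t j, x t j ∈ if (t, j) ∈ S then A (t, j) else Set.univ} =
      ⋂ i ∈ S, (fun E : Fin n → Fin p → ℝ => E i.1 i.2) ⁻¹' A i := by
    ext E
    simp only [Set.mem_ofPred_eq, Set.mem_iInter, Set.mem_preimage]
    constructor
    · intro hE i hi
      simpa [hi] using hE i.1 i.2
    · intro hE t j
      split_ifs with hS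
      · exact hE _ hS
      · trivial
  rw [h2] at h1
  rw [h1, ← Fintype.prod_prod_type' fun t j => ν t j (if (t, j) ∈ S then A (t, j) else Set.univ),
    ← Finset.prod_subset (Finset.subset_univ S)]
  · exact Finset.prod_congr rfl fun i hi => by simp [hi]
  · intro i _ hi
    simp [hi]

theorem IsEntrywiseProduct.map_entry (h : IsEntrywiseProduct p n P ν)
    (hν : ∀ t j, IsProbabilityMeasure (ν t j)) (i : Fin n) (j : Fin p) :
    P.map (fun E => E i j) = ν i j := by
  ext A hA
  rw [Measure.map_apply (measurable_entry i j) hA]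
  have := h.measure_biInter hν {(i, j)} (A := fun _ => A) fun _ _ => hA
  simpa using this

theorem isNoise_entries {α K : ℝ} (hα : 4 ≤ α) (hK : 0 < K) (hP : P ∈ Pclass p n α K) :
    IsNoise P (fun (i : Fin n × Fin p) (E : Fin n → Fin p → ℝ) => E i.1 i.2) (2 * K ^ 4) := by
  obtain ⟨ν, hm, hpr⟩ := hP
  have hν : ∀ t j, IsProbabilityMeasure (ν t j) := fun t j => (hm t j).1
  have hmap := hpr.map_entry hν
  have hintegral : ∀ (i : Fin n × Fin p) (f : ℝ → ℝ), Measurable f →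
      ∫ E, f (E i.1 i.2) ∂P = ∫ x, f x ∂ν i.1 i.2 := by
    intro i f hf
    rw [← hmap i.1 i.2, integral_map (measurable_entry _ _).aemeasurable
      hf.aestronglyMeasurable]
  refine ⟨?_, fun i => measurable_entry _ _, fun i => ?_, fun i => ?_, fun i => ?_, fun i => ?_⟩
  · rw [iIndepFun_iff_measure_inter_preimage_eq_mul]
    intro S A hA
    rw [hpr.measure_biInter hν S hA]
    refine Finset.prod_congr rfl fun i hi => ?_
    rw [← hmap i.1 i.2, Measure.map_apply (measurable_entry _ _) (hA i hi)]
  · have := (hm i.1 i.2).memLp_four hα hK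
    rw [← hmap i.1 i.2] at this
    exact (memLp_map_measure_iff measurable_id.aestronglyMeasurable
      (measurable_entry _ _).aemeasurable).1 this
  · rw [hintegral i (fun x => x) measurable_id]
    exact (hm i.1 i.2).2.2.1
  · rw [hintegral i (fun x => x ^ 2) (measurable_id.pow_const 2)]
    exact (hm i.1 i.2).integral_sq
  · rw [hintegral i (fun x => x ^ 4) (measurable_id.pow_const 4)]
    exact ((hm i.1 i.2).integrable_pow_four hα hK).2

theorem entries_rpow {α K : ℝ} (hK : 0 < K) (hP : P ∈ Pclass p n α K)
    (i : Fin n) (j : Fin p) :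
    Integrable (fun E : Fin n → Fin p → ℝ => |E i j| ^ α) P ∧ ∫ E, |E i j| ^ α ∂P ≤ K ^ α := by
  obtain ⟨ν, hm, hpr⟩ := hP
  have hmap := hpr.map_entry (fun t j => (hm t j).1) i j
  have hmeas : Measurable fun x : ℝ => |x / K| ^ α :=
    ((measurable_id.div_const K).norm).pow_const α
  have he : (fun E : Fin n → Fin p → ℝ => |E i j| ^ α) = fun E => K ^ α * |E i j / K| ^ α := by
    ext E
    rw [← Real.mul_rpow hK.le (abs_nonneg _), abs_div, abs_of_pos hK, mul_div_cancel₀ _ hK.ne']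
  have h1 := (hm i j).integrable_rpow
  rw [← hmap] at h1
  rw [integrable_map_measure hmeas.aestronglyMeasurable (measurable_entry i j).aemeasurable,
    integral_map (measurable_entry i j).aemeasurable hmeas.aestronglyMeasurable] at h1
  rw [he]
  refine ⟨h1.1.const_mul _, ?_⟩
  rw [integral_const_mul]
  exact mul_le_of_le_one_right (by positivity) h1.2

end Entries

section Contrast

variable {p n : ℕ}

/-- Weight of the `i`-th column in the `g`-th antisymmetric contrast of width `m`. -/
noncomputable def weight (n m g i : ℕ) : ℝ :=
  ((if i / m = g then 1 else 0) - (if (n - 1 - i) / m = g then 1 else 0)) / √(2 * m)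

/-- The `G` normalised contrasts, built from the first and last `G * m` columns. -/
noncomputable def contrast (p n G m : ℕ) (X : Fin n → Fin p → ℝ) (g : Fin G) (j : Fin p) : ℝ :=
  ∑ i : Fin n, weight n m g i * X i j

theorem contrast_add (G m : ℕ) (X Y : Fin n → Fin p → ℝ) (g : Fin G) (j : Fin p) :
    contrast p n G m (X + Y) g j = contrast p n G m X g j + contrast p n G m Y g j := by
  simp only [contrast, Pi.add_apply, mul_add, Finset.sum_add_distrib]

theorem measurable_contrast (G m : ℕ) (g : Fin G) (j : Fin p) :
    Measurable fun X => contrast p n G m X g j :=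
  Finset.measurable_sum _ fun i _ => (measurable_entry i j).const_mul _

theorem sum_ite_div_eq {m g : ℕ} (hm : 0 < m) (hg : (g + 1) * m ≤ n) :
    ∑ i : Fin n, (if (i : ℕ) / m = g then (1 : ℝ) else 0) = m := by
  rw [Fin.sum_univ_eq_sum_range (fun i => if i / m = g then (1 : ℝ) else 0) n,
    Finset.sum_boole]
  have : (Finset.range n).filter (fun i => i / m = g) = Finset.Ico (g * m) ((g + 1) * m) := by
    ext i
    simp only [Finset.mem_filter, Finset.mem_range, Finset.mem_Ico]
    rw [Nat.div_eq_iff hm]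
    have : (g + 1) * m = g * m + m := by ring
    constructor
    · rintro ⟨h1, h2, h3⟩
      omega
    · rintro ⟨h1, h2⟩
      omega
  rw [this, Nat.card_Ico]
  congr 1
  rw [Nat.add_mul]
  omega

theorem sum_ite_div_eq_reflect {m g : ℕ} (hm : 0 < m) (hg : (g + 1) * m ≤ n) :
    ∑ i : Fin n, (if (n - 1 - (i : ℕ)) / m = g then (1 : ℝ) else 0) = m := by
  rw [Fin.sum_univ_eq_sum_range (fun i => if (n - 1 - i) / m = g then (1 : ℝ) else 0) n,
    Finset.sum_range_reflect (fun i => if i / m = g then (1 : ℝ) else 0) n,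
    ← Fin.sum_univ_eq_sum_range (fun i => if i / m = g then (1 : ℝ) else 0) n,
    sum_ite_div_eq hm hg]

theorem lt_of_div_eq {m g G i : ℕ} (hm : 0 < m) (hg : g < G) (h : i / m = g) : i < G * m :=
  (Nat.div_lt_iff_lt_mul hm).1 (h ▸ hg)

theorem weight_group_unique {G m : ℕ} (hm : 0 < m) (hGm : 2 * (G * m) ≤ n) {g g' : Fin G}
    {i : Fin n} (h : weight n m g i ≠ 0) (h' : weight n m g' i ≠ 0) : g = g' := by
  have hi := i.2
  have key : ∀ g : Fin G, weight n m g i ≠ 0 → (i : ℕ) / m = g ∨ (n - 1 - i) / m = g := by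
    intro g hg
    by_contra! hc
    simp [weight, hc.1, hc.2] at hg
  rw [Fin.ext_iff]
  rcases key g h with h1 | h1 <;> rcases key g' h' with h2 | h2
  · omega
  · have := lt_of_div_eq hm g.2 h1
    have := lt_of_div_eq hm g'.2 h2
    omega
  · have := lt_of_div_eq hm g.2 h1
    have := lt_of_div_eq hm g'.2 h2
    omega
  · omega

theorem sum_weight_sq {G m : ℕ} (hm : 0 < m) (hGm : 2 * (G * m) ≤ n) (g : Fin G) :
    ∑ i : Fin n, weight n m g i ^ 2 = 1 := by
  have hm' : (0 : ℝ) < m := by exact_mod_cast hm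
  have hg : (g + 1 : ℕ) * m ≤ n := by
    have := Nat.mul_le_mul_right m g.2
    simp only [Nat.succ_eq_add_one] at this
    omega
  have : ∀ i : Fin n, weight n m g i ^ 2 = ((if (i : ℕ) / m = g then (1 : ℝ) else 0) +
      (if (n - 1 - (i : ℕ)) / m = g then (1 : ℝ) else 0)) / (2 * m) := by
    intro i
    rw [weight, div_pow, Real.sq_sqrt (by positivity)]
    have hi := i.2
    congr 1
    split_ifs with h1 h2
    · have := lt_of_div_eq hm g.2 h1
      have := lt_of_div_eq hm g.2 h2
      omega
    all_goals norm_num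
  simp_rw [this]
  rw [← Finset.sum_div, Finset.sum_add_distrib, sum_ite_div_eq hm hg,
    sum_ite_div_eq_reflect hm hg]
  field_simp
  ring

theorem isNoise_contrast {P : Measure (Fin n → Fin p → ℝ)} {α K : ℝ} (hα : 4 ≤ α) (hK : 0 < K)
    (hP : P ∈ Pclass p n α K) {G m : ℕ} (hm : 0 < m) (hGm : 2 * (G * m) ≤ n) :
    IsNoise P (fun (i : Fin G × Fin p) E => contrast p n G m E i.1 i.2) (3 + 2 * K ^ 4) := by
  have h := (isNoise_entries hα hK hP).blocks (by positivity)
    (fun k : Fin G × Fin p =>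
      (Finset.univ.filter fun i : Fin n => weight n m k.1 i ≠ 0) ×ˢ {k.2})
    (by
      intro k l hkl
      rw [Finset.disjoint_left]
      rintro ⟨i, j⟩ h1 h2
      simp only [Finset.mem_product, Finset.mem_filter, Finset.mem_univ, true_and,
        Finset.mem_singleton] at h1 h2
      exact hkl (Prod.ext (weight_group_unique hm hGm h1.1 h2.1) (h1.2.symm.trans h2.2)))
    (fun k i => weight n m k.1 i.1)
    (by
      intro k
      rw [Finset.sum_product]
      simp only [Finset.sum_singleton]
      rw [Finset.sum_filter_of_ne fun i _ hi => ?_]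
      · exact sum_weight_sq hm hGm k.1
      · exact fun h0 => hi (by rw [h0]; norm_num))
  convert h using 3 with k E
  rw [Finset.sum_product]
  simp only [Finset.sum_singleton]
  rw [Finset.sum_filter_of_ne fun i _ hi => left_ne_zero_of_mul hi]
  rfl

theorem contrast_of_two_means {G m t0 : ℕ} (hm : 0 < m) (h1 : G * m ≤ t0) (h2 : t0 + G * m ≤ n)
    {θ : Fin n → Fin p → ℝ} {μ₁ μ₂ : Fin p → ℝ} (hθ₁ : ∀ t : Fin n, (t : ℕ) < t0 → θ t = μ₁)
    (hθ₂ : ∀ t : Fin n, t0 ≤ (t : ℕ) → θ t = μ₂) (g : Fin G) (j : Fin p) :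
    contrast p n G m θ g j = √(m / 2) * (μ₁ j - μ₂ j) := by
  have hm' : (0 : ℝ) < m := by exact_mod_cast hm
  have hg : (g + 1 : ℕ) * m ≤ n := by
    have := Nat.mul_le_mul_right m g.2
    simp only [Nat.succ_eq_add_one] at this
    omega
  have : ∀ i : Fin n, weight n m g i * θ i j = ((if (i : ℕ) / m = g then (1 : ℝ) else 0) * μ₁ j -
      (if (n - 1 - (i : ℕ)) / m = g then (1 : ℝ) else 0) * μ₂ j) / √(2 * m) := by
    intro i
    have hi := i.2
    rw [weight]
    split_ifs with e1 e2 e2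
    · have := lt_of_div_eq hm g.2 e1
      have := lt_of_div_eq hm g.2 e2
      omega
    · have := lt_of_div_eq hm g.2 e1
      rw [hθ₁ i (by omega)]
      ring
    · have := lt_of_div_eq hm g.2 e2
      rw [hθ₂ i (by omega)]
      ring
    · simp
  rw [contrast]
  simp_rw [this]
  rw [← Finset.sum_div, Finset.sum_sub_distrib, ← Finset.sum_mul, ← Finset.sum_mul,
    sum_ite_div_eq hm hg, sum_ite_div_eq_reflect hm hg, div_eq_iff (by positivity),
    mul_right_comm, ← Real.sqrt_mul (by positivity),
    show (m : ℝ) / 2 * (2 * m) = m ^ 2 by ring, Real.sqrt_sq hm'.le]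
  ring

theorem contrast_of_const {G m : ℕ} (hm : 0 < m) (h : G * m ≤ n) {θ : Fin n → Fin p → ℝ}
    (hθ : θ ∈ Theta0 p n) (g : Fin G) (j : Fin p) : contrast p n G m θ g j = 0 := by
  obtain ⟨μ, hμ⟩ := hθ
  have hg : (g + 1 : ℕ) * m ≤ n := by
    have := Nat.mul_le_mul_right m g.2
    simp only [Nat.succ_eq_add_one] at this
    omega
  simp only [contrast, hμ]
  rw [← Finset.sum_mul]
  simp only [weight]
  rw [← Finset.sum_div, Finset.sum_sub_distrib, sum_ite_div_eq hm hg,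
    sum_ite_div_eq_reflect hm hg]
  simp

theorem contrast_one_one_rpow {P : Measure (Fin n → Fin p → ℝ)} {α K : ℝ} (hα : 0 ≤ α)
    (hK : 0 < K) (hP : P ∈ Pclass p n α K) (hn : 0 < n) (g : Fin 1) (j : Fin p) :
    Integrable (fun E => |contrast p n 1 1 E g j| ^ α) P ∧
      ∫ E, |contrast p n 1 1 E g j| ^ α ∂P ≤ 2 ^ α * (2 * K ^ α) := by
  have e : ∀ E, contrast p n 1 1 E g j = (E ⟨0, hn⟩ j - E ⟨n - 1, by omega⟩ j) / √2 := by
    intro E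
    have hw : ∀ i : Fin n, weight n 1 g i * E i j =
        ((if i = ⟨0, hn⟩ then E i j else 0) - (if i = ⟨n - 1, by omega⟩ then E i j else 0)) / √2 := by
      intro i
      have hi := i.2
      have c1 : (i : ℕ) / 1 = g ↔ i = ⟨0, hn⟩ := by
        rw [Fin.ext_iff, Nat.div_one]
        simp
      have c2 : (n - 1 - (i : ℕ)) / 1 = g ↔ i = ⟨n - 1, by omega⟩ := by
        rw [Fin.ext_iff, Nat.div_one]
        simp
        omega
      rw [weight, if_congr c1 rfl rfl, if_congr c2 rfl rfl]
      split_ifs <;> simp <;> ring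
    rw [contrast]
    simp_rw [hw]
    rw [← Finset.sum_div, Finset.sum_sub_distrib, Finset.sum_ite_eq', Finset.sum_ite_eq']
    simp
  have i1 := entries_rpow hK hP ⟨0, hn⟩ j
  have i2 := entries_rpow hK hP ⟨n - 1, by omega⟩ j
  have hb : ∀ E, |contrast p n 1 1 E g j| ^ α ≤
      2 ^ α * (|E ⟨0, hn⟩ j| ^ α + |E ⟨n - 1, by omega⟩ j| ^ α) := by
    intro E
    rw [e, abs_div]
    set a := E ⟨0, hn⟩ j
    set b := E ⟨n - 1, by omega⟩ j
    have h1 : |a - b| / |√2| ≤ 2 * max |a| |b| := by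
      have h2 : 1 ≤ |√2| := by
        rw [abs_of_nonneg (Real.sqrt_nonneg _)]
        exact Real.one_le_sqrt.2 one_le_two
      have h3 : |a - b| ≤ |a| + |b| := abs_sub _ _
      have a1 := le_max_left |a| |b|
      have a2 := le_max_right |a| |b|
      exact (div_le_self (abs_nonneg _) h2).trans (by linarith)
    refine (Real.rpow_le_rpow (by positivity) h1 hα).trans ?_
    rw [Real.mul_rpow zero_le_two (le_max_of_le_left (abs_nonneg _))]
    refine mul_le_mul_of_nonneg_left ?_ (by positivity)
    have n1 : 0 ≤ |a| ^ α := by positivity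
    have n2 : 0 ≤ |b| ^ α := by positivity
    rcases max_choice |a| |b| with e | e <;> rw [e] <;> linarith
  have hib := (i1.1.add i2.1).const_mul (2 ^ α)
  have hi : Integrable (fun E => |contrast p n 1 1 E g j| ^ α) P := by
    refine hib.mono' ((measurable_contrast 1 1 g j).norm.pow_const α).aestronglyMeasurable
      (Filter.Eventually.of_forall fun E => ?_)
    rw [Real.norm_of_nonneg (Real.rpow_nonneg (abs_nonneg _) _)]
    exact hb E
  refine ⟨hi, (integral_mono hi hib hb).trans ?_⟩
  rw [integral_const_mul]
  refine mul_le_mul_of_nonneg_left ?_ (by positivity)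
  have := integral_add i1.1 i2.1
  simp only [Pi.add_apply] at this ⊢
  rw [this]
  linarith [i1.2, i2.2]

end Contrast

section Lattice

/-- Integer directions in `ℤ^p` of squared norm at most `4 * s`. -/
noncomputable def latticeBall (p s : ℕ) : Finset (Fin p → ℤ) :=
  (Fintype.piFinset fun _ => Finset.Icc (-(4 * s : ℤ)) (4 * s)).filter fun z =>
    ∑ j, z j ^ 2 ≤ 4 * s

theorem mem_latticeBall {p s : ℕ} {z : Fin p → ℤ} :
    z ∈ latticeBall p s ↔ ∑ j, z j ^ 2 ≤ 4 * s := by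
  simp only [latticeBall, Finset.mem_filter, Fintype.mem_piFinset, Finset.mem_Icc,
    and_iff_right_iff_imp]
  intro h j
  have h1 : z j ^ 2 ≤ 4 * s := (Finset.single_le_sum (fun i _ => sq_nonneg (z i))
    (Finset.mem_univ j)).trans h
  have h2 : |z j| ≤ z j ^ 2 := by
    rw [← sq_abs]
    rcases (abs_nonneg (z j)).eq_or_lt with h0 | h0
    · simp [← h0]
    · nlinarith
  exact abs_le.1 (h2.trans h1)

theorem sum_pow_natAbs_sq_le {x : ℝ} (hx0 : 0 ≤ x) (hx : x ≤ 1 / 2) (B : ℕ) :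
    ∑ k ∈ Finset.Icc (-(B : ℤ)) B, x ^ (k.natAbs ^ 2) ≤ 1 + 4 * x := by
  have h : ∀ B : ℕ, ∑ k ∈ Finset.Icc (-(B : ℤ)) B, x ^ (k.natAbs ^ 2) ≤
      1 + 4 * x * (1 - (1 / 2) ^ B) := by
    intro B
    induction B with
    | zero => simp
    | succ B ih =>
      have hI : Finset.Icc (-((B + 1 : ℕ) : ℤ)) ((B + 1 : ℕ) : ℤ) =
          insert (-((B + 1 : ℕ) : ℤ)) (insert ((B + 1 : ℕ) : ℤ) (Finset.Icc (-(B : ℤ)) B)) := by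
        ext k
        simp only [Finset.mem_Icc, Finset.mem_insert]
        omega
      rw [hI, Finset.sum_insert, Finset.sum_insert]
      · have h1 : x ^ ((B + 1) ^ 2) ≤ x * (1 / 2) ^ B := by
          calc x ^ ((B + 1) ^ 2) ≤ x ^ (B + 1) :=
                pow_le_pow_of_le_one hx0 (by linarith) (by nlinarith)
            _ = x * x ^ B := by ring
            _ ≤ x * (1 / 2) ^ B :=
                mul_le_mul_of_nonneg_left (pow_le_pow_left₀ hx0 hx B) hx0
        rw [Int.natAbs_neg, Int.natAbs_natCast, pow_succ (1 / 2 : ℝ) B]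
        linarith
      · simp
      · simp only [Finset.mem_insert, Finset.mem_Icc]
        omega
  refine (h B).trans ?_
  have : (0 : ℝ) ≤ (1 / 2) ^ B := by positivity
  nlinarith

theorem card_latticeBall_le {p s : ℕ} (hs : 1 ≤ s) (hsp : s ≤ p) :
    ((latticeBall p s).card : ℝ) ≤ Real.exp (4 * s * Real.log (2 * (p / s)) + 2 * s) := by
  have hs' : (1 : ℝ) ≤ s := by exact_mod_cast hs
  have hsp' : (s : ℝ) ≤ p := by exact_mod_cast hsp
  have hp' : (0 : ℝ) < p := by linarith
  set x : ℝ := s / (2 * p) with hx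
  have hx0 : 0 < x := by positivity
  have hx1 : x ≤ 1 / 2 := by
    rw [hx, div_le_div_iff₀ (by positivity) (by norm_num)]
    linarith
  have h1 : ((latticeBall p s).card : ℝ) * x ^ (4 * s) ≤ (1 + 4 * x) ^ p := by
    calc ((latticeBall p s).card : ℝ) * x ^ (4 * s) = ∑ _z ∈ latticeBall p s, x ^ (4 * s) := by
          simp
      _ ≤ ∑ z ∈ latticeBall p s, ∏ j, x ^ ((z j).natAbs ^ 2) := by
          refine Finset.sum_le_sum fun z hz => ?_
          rw [Finset.prod_pow_eq_pow_sum]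
          refine pow_le_pow_of_le_one hx0.le (by linarith) ?_
          have := mem_latticeBall.1 hz
          have e : ((∑ j, (z j).natAbs ^ 2 : ℕ) : ℤ) = ∑ j, z j ^ 2 := by
            push_cast
            exact Finset.sum_congr rfl fun j _ => by simp
          omega
      _ ≤ ∑ z ∈ Fintype.piFinset fun _ : Fin p => Finset.Icc (-(4 * s : ℤ)) (4 * s),
            ∏ j, x ^ ((z j).natAbs ^ 2) :=
          Finset.sum_le_sum_of_subset_of_nonneg (Finset.filter_subset _ _)
            fun z _ _ => by positivity
      _ = ∏ _j : Fin p, ∑ k ∈ Finset.Icc (-(4 * s : ℤ)) (4 * s), x ^ (k.natAbs ^ 2) :=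
          (Finset.prod_univ_sum (fun _ : Fin p => Finset.Icc (-(4 * s : ℤ)) (4 * s))
            fun _ k => x ^ (k.natAbs ^ 2)).symm
      _ = (∑ k ∈ Finset.Icc (-(4 * s : ℤ)) (4 * s), x ^ (k.natAbs ^ 2)) ^ p := by simp
      _ ≤ (1 + 4 * x) ^ p := by
          refine pow_le_pow_left₀ (Finset.sum_nonneg fun _ _ => by positivity) ?_ p
          have := sum_pow_natAbs_sq_le hx0.le hx1 (4 * s)
          push_cast at this
          exact this
  have h2 : (1 + 4 * x) ^ p ≤ Real.exp (2 * s) := by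
    calc (1 + 4 * x) ^ p ≤ Real.exp (4 * x) ^ p := by
          refine pow_le_pow_left₀ (by positivity) ?_ p
          linarith [Real.add_one_le_exp (4 * x)]
      _ = Real.exp (2 * s) := by
          rw [← Real.exp_nat_mul]
          congr 1
          rw [hx]
          field_simp
          ring
  have h3 : x ^ (4 * s) = Real.exp (-(4 * s * Real.log (2 * (p / s)))) := by
    have : x = Real.exp (-Real.log (2 * (p / s))) := by
      rw [Real.exp_neg, Real.exp_log (by positivity), hx]
      field_simp
    rw [this, ← Real.exp_nat_mul]
    congr 1
    push_cast
    ring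
  rw [h3, Real.exp_neg, ← div_eq_mul_inv, div_le_iff₀ (Real.exp_pos _)] at h1
  rw [add_comm, Real.exp_add]
  exact h1.trans (mul_le_mul_of_nonneg_right h2 (Real.exp_pos _).le)

/-- The sparse rate `s (p / s) ^ (2 / α)`. -/
noncomputable def sparseRate (p : ℕ) (α : ℝ) (s : ℕ) : ℝ := s * ((p : ℝ) / s) ^ ((2 : ℝ) / α)

theorem le_sparseRate {p s : ℕ} {α : ℝ} (hα : 4 ≤ α) (hs : 1 ≤ s) (hsp : s ≤ p) :
    (s : ℝ) ≤ sparseRate p α s := by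
  have hs' : (1 : ℝ) ≤ s := by exact_mod_cast hs
  have hsp' : (s : ℝ) ≤ p := by exact_mod_cast hsp
  refine le_mul_of_one_le_right (by positivity) (Real.one_le_rpow ?_ (by positivity))
  rwa [one_le_div (by positivity)]

theorem card_latticeBall_le_sparseRate {p s : ℕ} {α : ℝ} (hα : 4 ≤ α) (hs : 1 ≤ s)
    (hsp : s ≤ p) :
    ((latticeBall p s).card : ℝ) ≤ Real.exp ((6 + 2 * α) * sparseRate p α s) := by
  have hs' : (1 : ℝ) ≤ s := by exact_mod_cast hs
  have hsp' : (s : ℝ) ≤ p := by exact_mod_cast hsp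
  refine (card_latticeBall_le hs hsp).trans (Real.exp_le_exp.2 ?_)
  set y : ℝ := p / s with hy
  have hy1 : 1 ≤ y := by rwa [hy, one_le_div (by positivity)]
  have hY : 1 ≤ y ^ (2 / α) := Real.one_le_rpow hy1 (by positivity)
  have h1 : Real.log y ≤ α / 2 * y ^ (2 / α) := by
    have e : Real.log (y ^ (2 / α)) = 2 / α * Real.log y := Real.log_rpow (by linarith) _
    have e2 : Real.log (y ^ (2 / α)) ≤ y ^ (2 / α) :=
      (Real.log_le_sub_one_of_pos (by linarith)).trans (by linarith)
    rw [e] at e2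
    calc Real.log y = α / 2 * (2 / α * Real.log y) := by field_simp
      _ ≤ _ := mul_le_mul_of_nonneg_left e2 (by linarith)
  have h2 : Real.log (2 * y) ≤ 1 + Real.log y := by
    rw [Real.log_mul (by norm_num) (by linarith)]
    linarith [Real.log_two_lt_d9]
  have e : sparseRate p α s = s * y ^ (2 / α) := rfl
  have : 4 * Real.log (2 * y) + 2 ≤ (6 + 2 * α) * y ^ (2 / α) := by nlinarith
  rw [e]
  nlinarith

theorem exists_latticeBall_direction {p s : ℕ} {h : Fin p → ℝ} (hs : l0 p h ≤ s)
    (hpos : 0 < sqnorm p h) :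
    ∃ z ∈ latticeBall p s, √s * √(sqnorm p h) ≤ ∑ j, (z j : ℝ) * h j := by
  set N := sqnorm p h with hN
  have hsN : 0 < √N := Real.sqrt_pos.2 hpos
  let w : Fin p → ℝ := fun j => 2 * √s * |h j| / √N
  have hw : ∀ j, 0 ≤ w j := fun j => by positivity
  let z : Fin p → ℤ := fun j => if 0 ≤ h j then ⌊w j⌋ else -⌊w j⌋
  have hz2 : ∀ j, ((z j : ℤ) : ℝ) ^ 2 ≤ w j ^ 2 := by
    intro j
    have h1 : (z j : ℤ) ^ 2 = ⌊w j⌋ ^ 2 := by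
      simp only [z]
      split_ifs <;> ring
    have h1' : ((z j : ℤ) : ℝ) ^ 2 = (⌊w j⌋ : ℝ) ^ 2 := by exact_mod_cast h1
    rw [h1']
    exact pow_le_pow_left₀ (by exact_mod_cast Int.floor_nonneg.2 (hw j)) (Int.floor_le _) 2
  have hzh : ∀ j, (w j - 1) * |h j| ≤ (z j : ℝ) * h j := by
    intro j
    have h1 : (z j : ℝ) * h j = ⌊w j⌋ * |h j| := by
      simp only [z]
      split_ifs with h0
      · rw [abs_of_nonneg h0]
      · rw [abs_of_neg (not_le.1 h0)]
        push_cast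
        ring
    rw [h1]
    exact mul_le_mul_of_nonneg_right (Int.sub_one_lt_floor _).le (abs_nonneg _)
  have hcs : ∑ j, |h j| ≤ √s * √N := by
    rw [← Real.sqrt_mul (by positivity)]
    refine Real.le_sqrt_of_sq_le ?_
    have e1 : ∑ j, |h j| = ∑ j ∈ Finset.univ.filter fun j => h j ≠ 0, |h j| := by
      rw [Finset.sum_filter_of_ne fun j _ hj => by simpa using hj]
    have e2 : ∑ j ∈ Finset.univ.filter (fun j => h j ≠ 0), |h j| ^ 2 ≤ N := by
      simp only [sq_abs]
      exact Finset.sum_le_sum_of_subset_of_nonneg (Finset.filter_subset _ _)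
        fun j _ _ => sq_nonneg _
    rw [e1]
    refine sq_sum_le_card_mul_sum_sq.trans ?_
    have : ((Finset.univ.filter fun j => h j ≠ 0).card : ℝ) ≤ s := by exact_mod_cast hs
    exact mul_le_mul this e2 (Finset.sum_nonneg fun _ _ => by positivity) (by positivity)
  have hwh : ∑ j, w j * |h j| = 2 * √s * √N := by
    have : ∀ j, w j * |h j| = 2 * √s / √N * h j ^ 2 := by
      intro j
      simp only [w]
      rw [← sq_abs (h j)]
      ring
    simp_rw [this]
    rw [← Finset.mul_sum, ← sqnorm, ← hN]
    nth_rewrite 2 [← Real.sq_sqrt hpos.le]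
    field_simp
  refine ⟨z, mem_latticeBall.2 ?_, ?_⟩
  · have : ((∑ j, z j ^ 2 : ℤ) : ℝ) ≤ ((4 * s : ℤ) : ℝ) := by
      push_cast
      calc ∑ j, (z j : ℝ) ^ 2 ≤ ∑ j, w j ^ 2 := Finset.sum_le_sum fun j _ => hz2 j
        _ = 4 * s := by
          have : ∀ j, w j ^ 2 = 4 * s / N * h j ^ 2 := by
            intro j
            simp only [w]
            rw [div_pow, mul_pow, mul_pow, sq_abs, Real.sq_sqrt (by positivity),
              Real.sq_sqrt hpos.le]
            ring
          simp_rw [this]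
          rw [← Finset.mul_sum, ← sqnorm, ← hN]
          field_simp
    exact_mod_cast this
  · calc √s * √N ≤ ∑ j, w j * |h j| - ∑ j, |h j| := by rw [hwh]; linarith
      _ = ∑ j, (w j - 1) * |h j| := by
          rw [← Finset.sum_sub_distrib]
          exact Finset.sum_congr rfl fun j _ => by ring
      _ ≤ _ := Finset.sum_le_sum fun j _ => hzh j

end Lattice

section Groups

/-- Logarithmic scale attached to the dyadic level `k`. -/
noncomputable def levelLog (k : ℕ) : ℝ := Real.log (k + 2) + 1

/-- Number of groups of the dense and coordinatewise subtests at level `k`. -/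
noncomputable def denseGroups (A : ℝ) (k : ℕ) : ℕ := ⌈A * levelLog k⌉₊

/-- Number of groups of the directional subtests at level `k` and sparsity `s`. -/
noncomputable def dirGroups (A α : ℝ) (p k s : ℕ) : ℕ := ⌈A * (levelLog k + sparseRate p α s)⌉₊

theorem one_le_levelLog (k : ℕ) : 1 ≤ levelLog k := by
  have : 0 ≤ Real.log (k + 2) := Real.log_nonneg (by linarith [Nat.cast_nonneg (α := ℝ) k])
  rw [levelLog]
  linarith

theorem levelLog_le (k : ℕ) : levelLog k ≤ k + 2 := by
  have : Real.log (k + 2) ≤ k + 2 - 1 := Real.log_le_sub_one_of_pos (by positivity)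
  rw [levelLog]
  linarith

theorem le_ceil_and_ceil_le_two_mul {y : ℝ} (hy : 1 ≤ y) : y ≤ ⌈y⌉₊ ∧ (⌈y⌉₊ : ℝ) ≤ 2 * y :=
  ⟨Nat.le_ceil y, by linarith [Nat.ceil_lt_add_one (zero_le_one.trans hy)]⟩

theorem exp_neg_levelLog_le {A : ℝ} (hA : 2 ≤ A) (k : ℕ) :
    Real.exp (-(A * levelLog k)) ≤ Real.exp (-A) * (1 / ((k : ℝ) + 2) ^ 2) := by
  have hk : (0 : ℝ) < k + 2 := by positivity
  have e : 1 / ((k : ℝ) + 2) ^ 2 = Real.exp (-(2 * Real.log (k + 2))) := by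
    rw [Real.exp_neg, mul_comm, Real.exp_mul, Real.exp_log hk, one_div]
    norm_num
  rw [e, ← Real.exp_add]
  refine Real.exp_le_exp.2 ?_
  have : 0 ≤ Real.log (k + 2) := Real.log_nonneg (by linarith [Nat.cast_nonneg (α := ℝ) k])
  rw [levelLog]
  nlinarith

theorem sum_one_div_sq_le (N : ℕ) : ∑ k ∈ Finset.range N, 1 / ((k : ℝ) + 2) ^ 2 ≤ 1 := by
  have h : ∑ k ∈ Finset.range N, 1 / ((k : ℝ) + 2) ^ 2 ≤ 1 - 1 / ((N : ℝ) + 1) := by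
    induction N with
    | zero => simp
    | succ N ih =>
      rw [Finset.sum_range_succ]
      have : 1 / ((N : ℝ) + 2) ^ 2 ≤ 1 / ((N : ℝ) + 1) - 1 / ((N : ℝ) + 2) := by
        rw [div_sub_div _ _ (by positivity) (by positivity),
          div_le_div_iff₀ (by positivity) (by positivity)]
        nlinarith [Nat.cast_nonneg (α := ℝ) N]
      push_cast
      rw [show (N : ℝ) + 1 + 1 = N + 2 by ring]
      linarith
  have : 0 ≤ 1 / ((N : ℝ) + 1) := by positivity
  linarith

theorem sum_exp_neg_le (p : ℕ) : ∑ s ∈ Finset.Icc 1 p, Real.exp (-(s : ℝ)) ≤ 1 := by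
  have h : ∑ s ∈ Finset.Icc 1 p, Real.exp (-(s : ℝ)) ≤ 1 - (1 / 2) ^ p := by
    induction p with
    | zero => simp
    | succ p ih =>
      rw [Finset.sum_Icc_succ_top (by omega)]
      have : Real.exp (-((p + 1 : ℕ) : ℝ)) ≤ (1 / 2) ^ (p + 1) := by
        have e : Real.exp (-((p + 1 : ℕ) : ℝ)) = Real.exp (-1) ^ (p + 1) := by
          rw [← Real.exp_nat_mul]
          congr 1
          ring
        rw [e]
        refine pow_le_pow_left₀ (Real.exp_pos _).le ?_ _
        rw [Real.exp_neg, one_div]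
        exact inv_anti₀ two_pos (by linarith [Real.add_one_le_exp 1])
      rw [pow_succ] at *
      linarith
  have : (0 : ℝ) ≤ (1 / 2) ^ p := by positivity
  linarith

theorem levelLog_le_three_mul_LL {n k : ℕ} (h : 2 * 2 ^ k ≤ n) : levelLog k ≤ 3 * LL n := by
  have hn : (2 : ℝ) * 2 ^ k ≤ n := by exact_mod_cast h
  have hk : (0 : ℝ) ≤ k := Nat.cast_nonneg k
  have h1 : 0.69 * ((k : ℝ) + 4) ≤ Real.log (8 * n) := by
    have h2 : Real.log (2 ^ (k + 4)) ≤ Real.log (8 * n) := by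
      refine Real.log_le_log (by positivity) ?_
      rw [pow_add]
      linarith
    rw [Real.log_pow] at h2
    push_cast at h2
    nlinarith [Real.log_two_gt_d9]
  have h2 : Real.exp (levelLog k) ≤ Real.log (8 * n) ^ 3 := by
    calc Real.exp (levelLog k) = (k + 2) * Real.exp 1 := by
          rw [levelLog, Real.exp_add, Real.exp_log (by positivity)]
      _ ≤ (k + 2) * 2.7182818286 :=
          mul_le_mul_of_nonneg_left Real.exp_one_lt_d9.le (by positivity)
      _ ≤ (0.69 * ((k : ℝ) + 4)) ^ 3 := by nlinarith [mul_nonneg hk hk, mul_nonneg hk (mul_nonneg hk hk)]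
      _ ≤ _ := pow_le_pow_left₀ (by positivity) h1 3
  have hpos : 0 < Real.log (8 * n) := lt_of_lt_of_le (by positivity) h1
  calc levelLog k = Real.log (Real.exp (levelLog k)) := (Real.log_exp _).symm
    _ ≤ Real.log (Real.log (8 * n) ^ 3) := Real.log_le_log (Real.exp_pos _) h2
    _ = 3 * LL n := by rw [Real.log_pow, LL]; norm_num

theorem exists_level_threshold (A β : ℝ) (hA : 0 < A) :
    ∃ k₀ : ℕ, ∀ k ≥ k₀, 2 * A * levelLog k ^ β ≤ 2 ^ k := by
  obtain ⟨N, hN⟩ := exists_nat_ge (max β 0)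
  have hNβ : β ≤ N := (le_max_left _ _).trans hN
  have h := (tendsto_pow_const_div_const_pow_of_one_lt N (one_lt_two (α := ℝ))).comp
    (Filter.tendsto_add_atTop_nat 2)
  have h2 := h.eventually_le_const (u := 1 / (8 * A)) (by positivity)
  obtain ⟨k₀, hk₀⟩ := Filter.eventually_atTop.1 h2
  refine ⟨k₀, fun k hk => ?_⟩
  have h3 := hk₀ k hk
  simp only [Function.comp_apply] at h3
  rw [div_le_div_iff₀ (by positivity) (by positivity)] at h3
  have h4 : levelLog k ^ β ≤ ((k + 2 : ℕ) : ℝ) ^ N := by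
    calc levelLog k ^ β ≤ levelLog k ^ (N : ℝ) :=
          Real.rpow_le_rpow_of_exponent_le (one_le_levelLog k) hNβ
      _ = levelLog k ^ N := Real.rpow_natCast _ _
      _ ≤ _ := by
        push_cast
        exact pow_le_pow_left₀ (zero_le_one.trans (one_le_levelLog k)) (levelLog_le k) N
  rw [pow_add] at h3
  nlinarith [mul_le_mul_of_nonneg_left h4 hA.le]

theorem half_div_le_natDiv {t G : ℕ} (hG : 0 < G) (h : G ≤ t) :
    (t : ℝ) / (2 * G) ≤ ((t / G : ℕ) : ℝ) := by
  rw [div_le_iff₀ (by positivity)]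
  have h1 : 1 ≤ t / G := (Nat.one_le_div_iff hG).2 h
  have h2 := Nat.lt_mul_div_succ t hG
  have h3 : t ≤ t / G * (2 * G) := by nlinarith
  exact_mod_cast h3

/-- The coordinatewise threshold is dominated by the sparse rate when the dimension is large
compared with the level. -/
theorem coord_threshold_le {A α q D l s p : ℝ} {G : ℕ} (hα : 4 ≤ α) (hA : 2 * α ≤ A)
    (hq : 0 < q) (hl : 1 ≤ l) (hs : 1 ≤ s) (hp : 1 ≤ p) (hsp : s < √p * l)
    (hlp : l ^ (3 * α) ≤ √p) (hG1 : A * l ≤ G) (hG2 : (G : ℝ) ≤ 2 * (A * l))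
    (hD : 8 * A * (12 + 8 * A / q) ≤ D) :
    4 * G * (4 * (Real.exp 1 * p ^ ((1 : ℝ) / G)) + 4 * G / q) ≤ D * (p / s) ^ (2 / α) := by
  have hA0 : 0 < A := by linarith
  have hα0 : 0 < α := by linarith
  have hw : 1 ≤ √p := Real.one_le_sqrt.2 hp
  set w := √p with hwdef
  set v := w ^ (1 / (3 * α)) with hv
  have hlv : l ≤ v := by
    rw [hv, one_div, Real.le_rpow_inv_iff_of_pos (by linarith) (by linarith) (by positivity)]
    exact hlp
  have hv1 : 1 ≤ v := hl.trans hlv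
  have hGA : A ≤ G := (le_mul_of_one_le_right hA0.le hl).trans hG1
  have hG0 : (0 : ℝ) < G := hA0.trans_le hGA
  have hv3 : v ^ 3 = w ^ (1 / α) := by
    rw [hv, ← Real.rpow_natCast, ← Real.rpow_mul (by linarith)]
    congr 1
    field_simp
    norm_num
  have hv6 : v ^ 6 = w ^ (2 / α) := by
    rw [hv, ← Real.rpow_natCast, ← Real.rpow_mul (by linarith)]
    congr 1
    field_simp
    norm_num
  have h1 : p ^ ((1 : ℝ) / G) ≤ v ^ 3 := by
    rw [hv3]
    have hpw : p = w ^ (2 : ℝ) := by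
      rw [hwdef, Real.rpow_two, Real.sq_sqrt (by linarith)]
    rw [hpw, ← Real.rpow_mul (by linarith)]
    refine Real.rpow_le_rpow_of_exponent_le hw ?_
    rw [mul_one_div, div_le_div_iff₀ hG0 hα0]
    linarith
  have h2 : v ^ 5 ≤ (p / s) ^ (2 / α) := by
    have h3 : w / l ≤ p / s := by
      rw [div_le_div_iff₀ (by linarith) (by linarith)]
      calc w * s ≤ w * (w * l) := mul_le_mul_of_nonneg_left hsp.le (by linarith)
        _ = p * l := by rw [← mul_assoc, hwdef, Real.mul_self_sqrt (by linarith)]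
    have h4 : l ^ (2 / α) ≤ v := by
      calc l ^ (2 / α) ≤ l ^ (1 : ℝ) := by
            refine Real.rpow_le_rpow_of_exponent_le hl ?_
            rw [div_le_one hα0]
            linarith
        _ = l := Real.rpow_one l
        _ ≤ v := hlv
    calc v ^ 5 = v ^ 6 / v := by field_simp
      _ ≤ v ^ 6 / l ^ (2 / α) := div_le_div_of_nonneg_left (by positivity) (by positivity) h4
      _ = (w / l) ^ (2 / α) := by rw [hv6, Real.div_rpow (by linarith) (by linarith)]
      _ ≤ _ := Real.rpow_le_rpow (by positivity) h3 (by positivity)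
  have hGv : (G : ℝ) ≤ 2 * A * v := by nlinarith
  have h5 : 4 * (Real.exp 1 * p ^ ((1 : ℝ) / G)) + 4 * G / q ≤ (12 + 8 * A / q) * v ^ 3 := by
    have e1 : Real.exp 1 * p ^ ((1 : ℝ) / G) ≤ 3 * v ^ 3 :=
      mul_le_mul (by linarith [Real.exp_one_lt_d9]) h1 (by positivity) (by norm_num)
    have e2 : v ≤ v ^ 3 := le_self_pow₀ hv1 (by norm_num)
    have e3 : 4 * G / q ≤ 8 * A / q * v ^ 3 := by
      rw [div_mul_eq_mul_div]
      refine div_le_div_of_nonneg_right ?_ hq.le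
      nlinarith
    linarith
  calc _ ≤ 4 * (2 * A * v) * ((12 + 8 * A / q) * v ^ 3) := by gcongr
    _ = 8 * A * (12 + 8 * A / q) * v ^ 4 := by ring
    _ ≤ D * v ^ 5 := by
        refine mul_le_mul hD (pow_le_pow_right₀ hv1 (by norm_num)) (by positivity) ?_
        exact le_trans (by positivity) hD
    _ ≤ _ := mul_le_mul_of_nonneg_left h2 (le_trans (by positivity) hD)

theorem exists_coord_ge {p s : ℕ} {h : Fin p → ℝ} (hs : l0 p h ≤ s) {x : ℝ} (hx : 0 < x)
    (hx' : s * x ≤ sqnorm p h) (hs1 : 1 ≤ s) : ∃ j, x ≤ h j ^ 2 := by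
  by_contra! hc
  have hs0 : (0 : ℝ) < s := by exact_mod_cast hs1
  have e1 : sqnorm p h = ∑ j ∈ Finset.univ.filter fun j => h j ≠ 0, h j ^ 2 := by
    rw [sqnorm, Finset.sum_filter_of_ne fun j _ hj => by simpa using hj]
  rcases (Finset.univ.filter fun j => h j ≠ 0).eq_empty_or_nonempty with he | hne
  · rw [he, Finset.sum_empty] at e1
    nlinarith
  · have h2 : ∑ j ∈ Finset.univ.filter (fun j => h j ≠ 0), h j ^ 2 <
        ∑ _j ∈ Finset.univ.filter (fun j => h j ≠ 0), x :=
      Finset.sum_lt_sum_of_nonempty hne fun j _ => hc j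
    have h3 : ((Finset.univ.filter fun j => h j ≠ 0).card : ℝ) ≤ s := by exact_mod_cast hs
    rw [Finset.sum_const, nsmul_eq_mul] at h2
    nlinarith

theorem sum_rpow_ge {p s : ℕ} {h : Fin p → ℝ} {α L : ℝ} (hα : 4 ≤ α) (hs : l0 p h ≤ s)
    (hs1 : 1 ≤ s) (hp : 0 < p) (hL : 1 ≤ L) (hH : L * sparseRate p α s ≤ sqnorm p h) :
    L * p ≤ ∑ j, |h j| ^ α := by
  have hs0 : (0 : ℝ) < s := by exact_mod_cast hs1
  have hp0 : (0 : ℝ) < p := by exact_mod_cast hp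
  set S := Finset.univ.filter fun j => h j ≠ 0
  have hcard : (S.card : ℝ) ≤ s := by exact_mod_cast hs
  have hα2 : 1 ≤ α / 2 := by linarith
  have e1 : sqnorm p h = ∑ j ∈ S, h j ^ 2 := by
    rw [sqnorm, Finset.sum_filter_of_ne fun j _ hj => by simpa using hj]
  have e2 : ∑ j, |h j| ^ α = ∑ j ∈ S, (h j ^ 2) ^ (α / 2) := by
    rw [Finset.sum_filter_of_ne (p := fun j => h j ≠ 0)
      (f := fun j => (h j ^ 2) ^ (α / 2)) fun j _ hj h0 => hj (by
        rw [h0]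
        simp [Real.zero_rpow (show α / 2 ≠ 0 by linarith)])]
    refine Finset.sum_congr rfl fun j _ => ?_
    rw [← sq_abs, ← Real.rpow_natCast, ← Real.rpow_mul (abs_nonneg _)]
    congr 1
    push_cast
    ring
  have hpm : (∑ j ∈ S, h j ^ 2) ^ (α / 2) ≤
      (S.card : ℝ) ^ (α / 2 - 1) * ∑ j ∈ S, (h j ^ 2) ^ (α / 2) :=
    Real.rpow_sum_le_const_mul_sum_rpow_of_nonneg S hα2 fun j _ => sq_nonneg _
  have hnn : 0 ≤ ∑ j ∈ S, (h j ^ 2) ^ (α / 2) := Finset.sum_nonneg fun j _ => by positivity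
  have h1 : (S.card : ℝ) ^ (α / 2 - 1) ≤ (s : ℝ) ^ (α / 2 - 1) :=
    Real.rpow_le_rpow (by positivity) hcard (by linarith)
  have h2 : (L * sparseRate p α s) ^ (α / 2) ≤
      (s : ℝ) ^ (α / 2 - 1) * ∑ j ∈ S, (h j ^ 2) ^ (α / 2) := by
    refine (Real.rpow_le_rpow ?_ (hH.trans_eq e1) (by linarith)).trans
      (hpm.trans (mul_le_mul_of_nonneg_right h1 hnn))
    rw [sparseRate]
    positivity
  have h3 : (L * sparseRate p α s) ^ (α / 2) = L ^ (α / 2) * ((s : ℝ) ^ (α / 2 - 1) * p) := by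
    rw [sparseRate, Real.mul_rpow (by linarith) (by positivity),
      Real.mul_rpow (by positivity) (by positivity), ← Real.rpow_mul (by positivity),
      show 2 / α * (α / 2) = 1 by field_simp, Real.rpow_one, Real.rpow_sub_one hs0.ne']
    field_simp
  rw [h3] at h2
  have h4 : L ≤ L ^ (α / 2) := by
    conv_lhs => rw [← Real.rpow_one L]
    exact Real.rpow_le_rpow_of_exponent_le hL hα2
  have h5 : 0 < (s : ℝ) ^ (α / 2 - 1) := by positivity
  rw [e2]
  refine le_of_mul_le_mul_left ?_ h5
  calc (s : ℝ) ^ (α / 2 - 1) * (L * p) = L * ((s : ℝ) ^ (α / 2 - 1) * p) := by ring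
    _ ≤ L ^ (α / 2) * ((s : ℝ) ^ (α / 2 - 1) * p) :=
        mul_le_mul_of_nonneg_right h4 (by positivity)
    _ ≤ _ := h2

end Groups

section AdaptiveTest

/-- Threshold of the coordinatewise subtest with `G` groups. -/
noncomputable def coordThreshold (p G : ℕ) : ℝ := √(Real.exp 1 * (p : ℝ) ^ ((1 : ℝ) / G))

/-- Threshold of the directional subtests at sparsity `s`. -/
noncomputable def dirThreshold (q : ℝ) (s : ℕ) : ℝ := √(4 * s / q)

/-- Threshold of the `ℓ_α` subtest. -/
noncomputable def powThreshold (α K q : ℝ) (p : ℕ) : ℝ := 2 ^ α * (2 * K ^ α) * p / q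

/-- Subtests run at the dyadic level `k`. -/
def RejectLevel (p n : ℕ) (α A q c : ℝ) (k : ℕ) (X : Fin n → Fin p → ℝ) : Prop :=
  (denseGroups A k ≤ 2 ^ k ∧
    (RejDense (c * √p) (contrast p n (denseGroups A k) (2 ^ k / denseGroups A k) X) ∨
      RejCoord (coordThreshold p (denseGroups A k))
        (contrast p n (denseGroups A k) (2 ^ k / denseGroups A k) X))) ∨
  ∃ s ∈ Finset.Icc 1 p, dirGroups A α p k s ≤ 2 ^ k ∧ ∃ z ∈ latticeBall p s,
    RejDir (dirThreshold q s) z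
      (contrast p n (dirGroups A α p k s) (2 ^ k / dirGroups A α p k s) X)

/-- Rejection rule of the adaptive test. -/
def Reject (p n : ℕ) (α K A q c : ℝ) (X : Fin n → Fin p → ℝ) : Prop :=
  (RejPow α (powThreshold α K q p) (contrast p n 1 1 X 0) ∨
    RejDense (c * √p) (contrast p n 1 1 X)) ∨
  ∃ k ∈ Finset.range (Nat.log 2 (n / 2) + 1), RejectLevel p n α A q c k X

variable {p n : ℕ} {α K A q c : ℝ}

theorem measurableSet_rejDense (G m : ℕ) (x : ℝ) :
    MeasurableSet {X | RejDense x (contrast p n G m X)} :=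
  measurableSet_majority fun g => measurableSet_lt measurable_const <|
    Finset.measurable_sum _ fun j _ => ((measurable_contrast G m g j).pow_const 2).sub_const 1

theorem measurableSet_rejDir (G m : ℕ) (x : ℝ) (z : Fin p → ℤ) :
    MeasurableSet {X | RejDir x z (contrast p n G m X)} :=
  measurableSet_majority fun g => measurableSet_lt measurable_const <|
    Finset.measurable_sum _ fun j _ => (measurable_contrast G m g j).const_mul _

theorem measurableSet_rejCoord (G m : ℕ) (b : ℝ) :
    MeasurableSet {X | RejCoord b (contrast p n G m X)} := by
  have : {X | RejCoord b (contrast p n G m X)} = ⋃ j, ⋂ g, {X | b < |contrast p n G m X g j|} := by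
    ext X
    simp [RejCoord]
  rw [this]
  exact MeasurableSet.iUnion fun j => MeasurableSet.iInter fun g =>
    measurableSet_lt measurable_const (measurable_contrast G m g j).norm

theorem measurableSet_rejectLevel (k : ℕ) :
    MeasurableSet {X | RejectLevel p n α A q c k X} := by
  have h : {X | ∃ s ∈ Finset.Icc 1 p, dirGroups A α p k s ≤ 2 ^ k ∧ ∃ z ∈ latticeBall p s,
      RejDir (dirThreshold q s) z
        (contrast p n (dirGroups A α p k s) (2 ^ k / dirGroups A α p k s) X)} =
      ⋃ s ∈ Finset.Icc 1 p, {_X | dirGroups A α p k s ≤ 2 ^ k} ∩ ⋃ z ∈ latticeBall p s,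
        {X | RejDir (dirThreshold q s) z
          (contrast p n (dirGroups A α p k s) (2 ^ k / dirGroups A α p k s) X)} := by
    ext X
    simp only [Set.mem_ofPred_eq, Set.mem_iUnion, Set.mem_inter_iff, exists_prop]
  refine MeasurableSet.union (MeasurableSet.inter (MeasurableSet.const _)
    ((measurableSet_rejDense _ _ _).union (measurableSet_rejCoord _ _ _))) ?_
  refine (congrArg MeasurableSet h).mpr <| Finset.measurableSet_biUnion _ fun s _ =>
    (MeasurableSet.const _).inter <|
      Finset.measurableSet_biUnion _ fun z _ => measurableSet_rejDir _ _ _ _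

theorem measurableSet_reject : MeasurableSet {X | Reject p n α K A q c X} := by
  have h : {X | ∃ k ∈ Finset.range (Nat.log 2 (n / 2) + 1), RejectLevel p n α A q c k X} =
      ⋃ k ∈ Finset.range (Nat.log 2 (n / 2) + 1), {X | RejectLevel p n α A q c k X} := by
    ext X
    simp only [Set.mem_ofPred_eq, Set.mem_iUnion, exists_prop]
  refine MeasurableSet.union (MeasurableSet.union ?_ (measurableSet_rejDense _ _ _)) ?_
  · exact measurableSet_lt measurable_const <|
      Finset.measurable_sum _ fun j _ => (measurable_contrast 1 1 0 j).norm.pow_const α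
  · exact (congrArg MeasurableSet h).mpr <|
      Finset.measurableSet_biUnion _ fun k _ => measurableSet_rejectLevel k

theorem two_mul_mul_div_le {G k : ℕ} (hk : 2 * 2 ^ k ≤ n) : 2 * (G * (2 ^ k / G)) ≤ n :=
  (Nat.mul_le_mul_left 2 (Nat.mul_div_le _ _)).trans hk

theorem two_mul_two_pow_le {k : ℕ} (hn : 2 ≤ n)
    (hk : k ∈ Finset.range (Nat.log 2 (n / 2) + 1)) : 2 * 2 ^ k ≤ n := by
  have h1 : k ≤ Nat.log 2 (n / 2) := Nat.lt_succ_iff.1 (Finset.mem_range.1 hk)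
  have h2 : 2 ^ k ≤ n / 2 := (Nat.pow_le_pow_right two_pos h1).trans
    (Nat.pow_log_le_self 2 (by omega))
  omega

theorem two_mul_sqrt_pow_le {q y : ℝ} {G : ℕ} (hq1 : q ≤ 1 / 100) (hG : y ≤ G) :
    (2 * √q) ^ G ≤ Real.exp (-y) := by
  have h1 : √q ≤ 1 / 10 := by
    rw [Real.sqrt_le_left (by norm_num)]
    linarith
  have h2 : 2 * √q ≤ Real.exp (-1) := by
    have : 1 / 3 ≤ Real.exp (-1) := by
      rw [Real.exp_neg, one_div]
      exact inv_anti₀ (Real.exp_pos 1) (by linarith [Real.exp_one_lt_d9])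
    linarith
  calc (2 * √q) ^ G ≤ Real.exp (-1) ^ G := pow_le_pow_left₀ (by positivity) h2 G
    _ = Real.exp (-G) := by
      rw [← Real.exp_nat_mul]
      congr 1
      ring
    _ ≤ _ := Real.exp_le_exp.2 (by linarith)

theorem natDiv_pos {t G : ℕ} (hG : 0 < G) (h : G ≤ t) : 0 < t / G := Nat.div_pos h hG

theorem denseGroups_pos (hA : 0 < A) (k : ℕ) : 0 < denseGroups A k :=
  Nat.ceil_pos.2 (mul_pos hA (zero_lt_one.trans_le (one_le_levelLog k)))

theorem dirGroups_pos (hA : 0 < A) (k s : ℕ) : 0 < dirGroups A α p k s := by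
  have : 0 ≤ sparseRate p α s := by
    rw [sparseRate]
    positivity
  exact Nat.ceil_pos.2 (mul_pos hA (by linarith [one_le_levelLog k]))

theorem rejectLevel_null {P : Measure (Fin n → Fin p → ℝ)} (hα : 4 ≤ α) (hK : 0 < K)
    (hP : P ∈ Pclass p n α K) (hp : 0 < p) (hA : 8 + 2 * α ≤ A) (hq : 0 < q) (hq1 : q ≤ 1 / 100)
    (hc : 0 < c) (hcq : (3 + 2 * K ^ 4) / c ^ 2 ≤ q) {k : ℕ} (hk : 2 * 2 ^ k ≤ n) :
    P.real {E | RejectLevel p n α A q c k E} ≤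
      3 * (Real.exp (-A) * (1 / ((k : ℝ) + 2) ^ 2)) := by
  have hPP : IsProbabilityMeasure P := (isNoise_entries hα hK hP).indep.isProbabilityMeasure
  have hp' : (1 : ℝ) ≤ p := by exact_mod_cast hp
  have hA0 : 0 < A := by linarith
  have hl := one_le_levelLog k
  have hexp := exp_neg_levelLog_le (by linarith : 2 ≤ A) k
  have hG := denseGroups_pos hA0 k
  have hnonneg : 0 ≤ Real.exp (-(A * levelLog k)) := (Real.exp_pos _).le
  have b1 : P.real {E | denseGroups A k ≤ 2 ^ k ∧
      (RejDense (c * √p) (contrast p n (denseGroups A k) (2 ^ k / denseGroups A k) E) ∨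
      RejCoord (coordThreshold p (denseGroups A k))
        (contrast p n (denseGroups A k) (2 ^ k / denseGroups A k) E))} ≤
      2 * Real.exp (-(A * levelLog k)) := by
    by_cases hle : denseGroups A k ≤ 2 ^ k
    swap
    · simp [hle]
      positivity
    have hm := natDiv_pos hG hle
    have hU := isNoise_contrast hα hK hP hm (two_mul_mul_div_le (G := denseGroups A k) hk)
    have d1 := hU.dense_null hc hcq (by linarith) hp
    have d2 := hU.coord_null (b := coordThreshold p (denseGroups A k))
      (Real.sqrt_pos.2 (by positivity))
    have d1' := d1.trans (two_mul_sqrt_pow_le hq1 (Nat.le_ceil (A * levelLog k)))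
    have d2' : (p : ℝ) * (1 / coordThreshold p (denseGroups A k) ^ 2) ^ denseGroups A k ≤
        Real.exp (-(A * levelLog k)) := by
      have hG' : (denseGroups A k : ℝ) ≠ 0 := by exact_mod_cast hG.ne'
      rw [coordThreshold, Real.sq_sqrt (by positivity), one_div_pow, mul_pow,
        ← Real.rpow_natCast ((p : ℝ) ^ _), ← Real.rpow_mul (by positivity),
        one_div_mul_cancel hG', Real.rpow_one, ← Real.exp_nat_mul]
      calc (p : ℝ) * (1 / (Real.exp (denseGroups A k * 1) * p))
          = Real.exp (-(denseGroups A k)) := by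
            rw [mul_one, Real.exp_neg]
            field_simp
        _ ≤ _ := Real.exp_le_exp.2 (neg_le_neg (Nat.le_ceil _))
    calc _ ≤ P.real ({E | RejDense (c * √p)
            (contrast p n (denseGroups A k) (2 ^ k / denseGroups A k) E)} ∪
          {E | RejCoord (coordThreshold p (denseGroups A k))
            (contrast p n (denseGroups A k) (2 ^ k / denseGroups A k) E)}) :=
          measureReal_mono (fun E hE => hE.2) (measure_ne_top _ _)
      _ ≤ _ := measureReal_union_le _ _
      _ ≤ _ := by
          have e := add_le_add d1' (d2.trans d2')
          rw [← two_mul] at e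
          exact e
  have b2 : P.real {E | ∃ s ∈ Finset.Icc 1 p, dirGroups A α p k s ≤ 2 ^ k ∧
      ∃ z ∈ latticeBall p s, RejDir (dirThreshold q s) z
        (contrast p n (dirGroups A α p k s) (2 ^ k / dirGroups A α p k s) E)} ≤
      Real.exp (-(A * levelLog k)) := by
    have hsub : {E | ∃ s ∈ Finset.Icc 1 p, dirGroups A α p k s ≤ 2 ^ k ∧
        ∃ z ∈ latticeBall p s, RejDir (dirThreshold q s) z
          (contrast p n (dirGroups A α p k s) (2 ^ k / dirGroups A α p k s) E)} ⊆
        ⋃ s ∈ Finset.Icc 1 p, ⋃ z ∈ latticeBall p s, {E | dirGroups A α p k s ≤ 2 ^ k ∧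
          RejDir (dirThreshold q s) z
            (contrast p n (dirGroups A α p k s) (2 ^ k / dirGroups A α p k s) E)} := by
      rintro E ⟨s, hs, h1, z, hz, h2⟩
      simp only [Set.mem_iUnion, Set.mem_ofPred_eq, exists_prop]
      exact ⟨s, hs, z, hz, h1, h2⟩
    refine (measureReal_mono hsub (measure_ne_top _ _)).trans
      ((measureReal_biUnion_finset_le _ _).trans ?_)
    calc _ ≤ ∑ s ∈ Finset.Icc 1 p, Real.exp (-(A * levelLog k)) * Real.exp (-(s : ℝ)) := by
          refine Finset.sum_le_sum fun s hs => ?_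
          obtain ⟨hs1, hsp⟩ := Finset.mem_Icc.1 hs
          refine (measureReal_biUnion_finset_le _ _).trans ?_
          have hs0 : (0 : ℝ) < s := by exact_mod_cast hs1
          have hGs := dirGroups_pos (α := α) (p := p) hA0 k s
          have hone : ∀ z ∈ latticeBall p s, P.real {E | dirGroups A α p k s ≤ 2 ^ k ∧
              RejDir (dirThreshold q s) z
                (contrast p n (dirGroups A α p k s) (2 ^ k / dirGroups A α p k s) E)} ≤
              Real.exp (-(A * (levelLog k + sparseRate p α s))) := by
            intro z hz
            by_cases hle : dirGroups A α p k s ≤ 2 ^ k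
            swap
            · simp only [hle, false_and]
              rw [show {E : Fin n → Fin p → ℝ | False} = ∅ from rfl, measureReal_empty]
              positivity
            have hm := natDiv_pos hGs hle
            have hU := isNoise_contrast hα hK hP hm
              (two_mul_mul_div_le (G := dirGroups A α p k s) hk)
            have d := hU.dir_null (x := dirThreshold q s) (q := q) (z := z)
              (Real.sqrt_pos.2 (by positivity)) (by
                rw [dirThreshold, Real.sq_sqrt (by positivity), div_le_iff₀ (by positivity),
                  mul_div_cancel₀ _ hq.ne']
                exact_mod_cast mem_latticeBall.1 hz) (by linarith)
            refine le_trans (measureReal_mono (fun E hE => hE.2) (measure_ne_top _ _))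
              (d.trans (two_mul_sqrt_pow_le hq1 (Nat.le_ceil _)))
          refine (Finset.sum_le_card_nsmul _ _ _ hone).trans ?_
          rw [nsmul_eq_mul]
          refine (mul_le_mul_of_nonneg_right (card_latticeBall_le_sparseRate hα hs1 hsp)
            (Real.exp_pos _).le).trans ?_
          rw [← Real.exp_add, ← Real.exp_add]
          refine Real.exp_le_exp.2 ?_
          have := le_sparseRate hα hs1 hsp
          nlinarith
      _ = Real.exp (-(A * levelLog k)) * ∑ s ∈ Finset.Icc 1 p, Real.exp (-(s : ℝ)) := by
          rw [Finset.mul_sum]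
      _ ≤ _ := mul_le_of_le_one_right hnonneg (sum_exp_neg_le p)
  calc _ ≤ _ := measureReal_union_le _ _
    _ ≤ 2 * Real.exp (-(A * levelLog k)) + Real.exp (-(A * levelLog k)) := add_le_add b1 b2
    _ = 3 * Real.exp (-(A * levelLog k)) := by ring
    _ ≤ _ := by linarith

theorem reject_null {P : Measure (Fin n → Fin p → ℝ)} (hα : 4 ≤ α) (hK : 0 < K)
    (hP : P ∈ Pclass p n α K) (hp : 0 < p) (hn : 2 ≤ n) (hA : 8 + 2 * α ≤ A) (hq : 0 < q)
    (hq1 : q ≤ 1 / 100) (hc : 0 < c) (hcq : (3 + 2 * K ^ 4) / c ^ 2 ≤ q) :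
    P.real {E | Reject p n α K A q c E} ≤ 3 * q + 3 * Real.exp (-A) := by
  have hPP : IsProbabilityMeasure P := (isNoise_entries hα hK hP).indep.isProbabilityMeasure
  have b1 : P.real {E | RejPow α (powThreshold α K q p) (contrast p n 1 1 E 0)} ≤ q :=
    pow_null hp (by positivity) hq
      (fun j => (contrast_one_one_rpow (by linarith) hK hP (by omega) 0 j).1)
      fun j => (contrast_one_one_rpow (by linarith) hK hP (by omega) 0 j).2
  have b2 : P.real {E | RejDense (c * √p) (contrast p n 1 1 E)} ≤ 2 * q :=
    (isNoise_contrast hα hK hP one_pos (by omega)).dense_null_two_mul hc hcq hp one_pos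
  have b3 : P.real {E | ∃ k ∈ Finset.range (Nat.log 2 (n / 2) + 1),
      RejectLevel p n α A q c k E} ≤ 3 * Real.exp (-A) := by
    have hsub : {E | ∃ k ∈ Finset.range (Nat.log 2 (n / 2) + 1), RejectLevel p n α A q c k E} ⊆
        ⋃ k ∈ Finset.range (Nat.log 2 (n / 2) + 1), {E | RejectLevel p n α A q c k E} := by
      rintro E ⟨k, hk, h⟩
      simp only [Set.mem_iUnion, exists_prop]
      exact ⟨k, hk, h⟩
    refine (measureReal_mono hsub (measure_ne_top _ _)).trans
      ((measureReal_biUnion_finset_le _ _).trans ?_)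
    calc _ ≤ ∑ k ∈ Finset.range (Nat.log 2 (n / 2) + 1),
          3 * Real.exp (-A) * (1 / ((k : ℝ) + 2) ^ 2) := by
          refine Finset.sum_le_sum fun k hk => ?_
          rw [mul_assoc]
          exact rejectLevel_null hα hK hP hp hA hq hq1 hc hcq (two_mul_two_pow_le hn hk)
      _ ≤ _ := by
          rw [← Finset.mul_sum]
          exact mul_le_of_le_one_right (by positivity) (sum_one_div_sq_le _)
  calc _ ≤ _ := measureReal_union_le _ _
    _ ≤ (q + 2 * q) + 3 * Real.exp (-A) :=
        add_le_add ((measureReal_union_le _ _).trans (add_le_add b1 b2)) b3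
    _ = _ := by ring

theorem reject_add_of_mem_Theta0 {θ : Fin n → Fin p → ℝ} (hθ : θ ∈ Theta0 p n) (hn : 2 ≤ n)
    (hA : 0 < A) (E : Fin n → Fin p → ℝ) :
    Reject p n α K A q c (θ + E) ↔ Reject p n α K A q c E := by
  have key : ∀ {G m : ℕ}, 0 < m → 2 * (G * m) ≤ n →
      contrast p n G m (θ + E) = contrast p n G m E := by
    intro G m hm hGm
    ext g j
    rw [contrast_add, contrast_of_const hm (by omega) hθ, zero_add]
  have hlev : ∀ k ∈ Finset.range (Nat.log 2 (n / 2) + 1),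
      (RejectLevel p n α A q c k (θ + E) ↔ RejectLevel p n α A q c k E) := by
    intro k hk
    have hk' := two_mul_two_pow_le hn hk
    have hk2 : ∀ G, 0 < G → G ≤ 2 ^ k →
        contrast p n G (2 ^ k / G) (θ + E) = contrast p n G (2 ^ k / G) E := fun G hG hle =>
      key (natDiv_pos hG hle) (two_mul_mul_div_le hk')
    unfold RejectLevel
    refine or_congr (and_congr_right fun hle => ?_)
      (exists_congr fun s => and_congr_right fun _ => and_congr_right fun hle => ?_)
    · rw [hk2 _ (denseGroups_pos hA k) hle]
    · rw [hk2 _ (dirGroups_pos hA k s) hle]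
  unfold Reject
  rw [key one_pos (by omega)]
  exact or_congr_right (exists_congr fun k => and_congr_right fun hk => hlev k hk)

end AdaptiveTest

section Power

variable {p n : ℕ} {α K A q c : ℝ} {P : Measure (Fin n → Fin p → ℝ)}
  {θ : Fin n → Fin p → ℝ} {μ₁ μ₂ : Fin p → ℝ} {t0 : ℕ}

theorem sqnorm_const_mul (a : ℝ) (v : Fin p → ℝ) :
    sqnorm p (fun j => a * v j) = a ^ 2 * sqnorm p v := by
  simp only [sqnorm, mul_pow, Finset.mul_sum]

theorem l0_const_mul_le (a : ℝ) (v : Fin p → ℝ) : l0 p (fun j => a * v j) ≤ l0 p v :=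
  Finset.card_le_card fun j hj => by
    simp only [Finset.mem_filter, Finset.mem_univ, true_and] at hj ⊢
    exact right_ne_zero_of_mul hj

theorem sqnorm_group_signal_ge {t G : ℕ} (hG : 0 < G) (h : G ≤ t) (δ : Fin p → ℝ) :
    t * sqnorm p δ / (4 * G) ≤ sqnorm p fun j => √(((t / G : ℕ) : ℝ) / 2) * δ j := by
  have hN : 0 ≤ sqnorm p δ := Finset.sum_nonneg fun j _ => sq_nonneg _
  rw [sqnorm_const_mul, Real.sq_sqrt (by positivity)]
  calc t * sqnorm p δ / (4 * G) = (t / (2 * G)) / 2 * sqnorm p δ := by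
        field_simp
        ring
    _ ≤ _ := by
        have := half_div_le_natDiv hG h
        gcongr

theorem contrast_add_of_two_means {G m : ℕ} (hm : 0 < m) (h1 : G * m ≤ t0) (h2 : t0 + G * m ≤ n)
    (hθ₁ : ∀ t : Fin n, (t : ℕ) < t0 → θ t = μ₁) (hθ₂ : ∀ t : Fin n, t0 ≤ (t : ℕ) → θ t = μ₂)
    (E : Fin n → Fin p → ℝ) :
    contrast p n G m (θ + E) =
      fun g j => √((m : ℝ) / 2) * (μ₁ j - μ₂ j) + contrast p n G m E g j := by
  ext g j
  rw [contrast_add, contrast_of_two_means hm h1 h2 hθ₁ hθ₂]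

theorem rejectLevel_power (hα : 4 ≤ α) (hK : 0 < K) (hP : P ∈ Pclass p n α K) (hp : 0 < p)
    (hA : 8 + 2 * α ≤ A) (hq : 0 < q) (hc : 0 < c) (hcq : (3 + 2 * K ^ 4) / c ^ 2 + 4 / c ≤ q)
    {k s : ℕ} {D : ℝ} (hs1 : 1 ≤ s) (hsp : s ≤ p) (hk : 2 * A * levelLog k ^ (3 * α + 1) ≤ 2 ^ k)
    (h1 : 2 ^ k ≤ t0) (h2 : t0 + 2 ^ k ≤ n)
    (hθ₁ : ∀ t : Fin n, (t : ℕ) < t0 → θ t = μ₁) (hθ₂ : ∀ t : Fin n, t0 ≤ (t : ℕ) → θ t = μ₂)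
    (hs : l0 p (fun j => μ₁ j - μ₂ j) ≤ s)
    (hD1 : 32 * A * c ≤ D) (hD2 : 128 * A / q ≤ D) (hD3 : 8 * A * (12 + 8 * A / q) ≤ D)
    (hN : D * min (√p * levelLog k) (sparseRate p α s + levelLog k) ≤
      2 ^ k * sqnorm p fun j => μ₁ j - μ₂ j) :
    P.real {E | ¬RejectLevel p n α A q c k (θ + E)} ≤ 2 * q := by
  have hPP : IsProbabilityMeasure P := (isNoise_entries hα hK hP).indep.isProbabilityMeasure
  have hp' : (1 : ℝ) ≤ p := by exact_mod_cast hp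
  have hs' : (1 : ℝ) ≤ s := by exact_mod_cast hs1
  have hA0 : 0 < A := by linarith
  have hl := one_le_levelLog k
  have hsr := le_sparseRate hα hs1 hsp
  have hD0 : 0 < D := lt_of_lt_of_le (by positivity) hD2
  have hG0 := denseGroups_pos hA0 k
  obtain ⟨hG1, hG2⟩ := le_ceil_and_ceil_le_two_mul (y := A * levelLog k) (by nlinarith)
  change A * levelLog k ≤ (denseGroups A k : ℝ) at hG1
  change (denseGroups A k : ℝ) ≤ 2 * (A * levelLog k) at hG2
  have hGs0 := dirGroups_pos (α := α) (p := p) hA0 k s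
  obtain ⟨-, hGs2⟩ := le_ceil_and_ceil_le_two_mul (y := A * (levelLog k + sparseRate p α s))
    (by nlinarith)
  change (dirGroups A α p k s : ℝ) ≤ 2 * (A * (levelLog k + sparseRate p α s)) at hGs2
  set δ : Fin p → ℝ := fun j => μ₁ j - μ₂ j with hδ
  have hnk : 2 * 2 ^ k ≤ n := by omega
  have hGt : denseGroups A k ≤ 2 ^ k := by
    have h3 : levelLog k ≤ levelLog k ^ (3 * α + 1) :=
      Real.self_le_rpow_of_one_le hl (by linarith)
    have : (denseGroups A k : ℝ) ≤ 2 ^ k := by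
      refine hG2.trans (le_trans ?_ hk)
      rw [← mul_assoc]
      exact mul_le_mul_of_nonneg_left h3 (by positivity)
    exact_mod_cast this
  have hcon : ∀ G, 0 < G → G ≤ 2 ^ k → ∀ E, contrast p n G (2 ^ k / G) (θ + E) =
      fun g j => √(((2 ^ k / G : ℕ) : ℝ) / 2) * δ j + contrast p n G (2 ^ k / G) E g j := by
    intro G hG hle E
    have := Nat.mul_div_le (2 ^ k) G
    exact contrast_add_of_two_means (natDiv_pos hG hle) (by omega) (by omega) hθ₁ hθ₂ E
  have hsig : ∀ G, 0 < G → G ≤ 2 ^ k → 2 ^ k * sqnorm p δ / (4 * G) ≤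
      sqnorm p fun j => √(((2 ^ k / G : ℕ) : ℝ) / 2) * δ j := by
    intro G hG hle
    have := sqnorm_group_signal_ge (p := p) hG hle δ
    rwa [Nat.cast_pow, Nat.cast_ofNat] at this
  have hl0 : ∀ a : ℝ, l0 p (fun j => a * δ j) ≤ s := fun a => (l0_const_mul_le a δ).trans hs
  have hnoise : ∀ G, 0 < G → G ≤ 2 ^ k →
      IsNoise P (fun (i : Fin G × Fin p) E => contrast p n G (2 ^ k / G) E i.1 i.2) (3 + 2 * K ^ 4) :=
    fun G hG hle => isNoise_contrast hα hK hP (natDiv_pos hG hle) (two_mul_mul_div_le hnk)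
  have hGr : (0 : ℝ) < denseGroups A k := by exact_mod_cast hG0
  rcases le_or_gt (√p * levelLog k) (sparseRate p α s + levelLog k) with hcase | hcase
  · rw [min_eq_left hcase] at hN
    have hpow := (hnoise _ hG0 hGt).dense_power hc hcq hp hG0 _ <| le_trans (by
      rw [le_div_iff₀ (by positivity)]
      refine le_trans ?_ hN
      calc 4 * c * √p * (4 * (denseGroups A k : ℝ))
          ≤ 4 * c * √p * (4 * (2 * (A * levelLog k))) := by gcongr
        _ = 32 * A * c * (√p * levelLog k) := by ring
        _ ≤ _ := by gcongr) (hsig _ hG0 hGt)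
    refine le_trans (measureReal_mono_pred fun E hE => ?_) hpow
    contrapose! hE
    refine Or.inl ⟨hGt, Or.inl ?_⟩
    rw [hcon _ hG0 hGt]
    exact hE
  rw [min_eq_right hcase.le] at hN
  rcases le_or_gt (dirGroups A α p k s) (2 ^ k) with hdir | hdir
  · have hGsr : (0 : ℝ) < dirGroups A α p k s := by exact_mod_cast hGs0
    have hbig : 16 / q ≤ sqnorm p fun j => √(((2 ^ k / dirGroups A α p k s : ℕ) : ℝ) / 2) * δ j := by
      refine le_trans ?_ (hsig _ hGs0 hdir)
      rw [le_div_iff₀ (by positivity)]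
      refine le_trans ?_ hN
      calc 16 / q * (4 * (dirGroups A α p k s : ℝ))
          ≤ 16 / q * (4 * (2 * (A * (levelLog k + sparseRate p α s)))) := by gcongr
        _ = 128 * A / q * (sparseRate p α s + levelLog k) := by ring
        _ ≤ _ := mul_le_mul_of_nonneg_right hD2 (by linarith)
    obtain ⟨z, hz, hzh⟩ := exists_latticeBall_direction (hl0 _)
      (lt_of_lt_of_le (by positivity) hbig)
    have hpow := (hnoise _ hGs0 hdir).dir_power (x := dirThreshold q s) (q := q) (z := z)
      (Real.sqrt_pos.2 (by positivity)) (by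
        rw [dirThreshold, Real.sq_sqrt (by positivity), div_le_iff₀ (by positivity),
          mul_div_cancel₀ _ hq.ne']
        exact_mod_cast mem_latticeBall.1 hz) hGs0 _ (le_trans (by
          rw [dirThreshold, ← Real.sqrt_mul (by positivity)]
          refine Real.le_sqrt_of_sq_le ?_
          rw [mul_pow, Real.sq_sqrt (by positivity)]
          calc (2 : ℝ) ^ 2 * (4 * s / q) = s * (16 / q) := by ring
            _ ≤ _ := by gcongr) hzh)
    refine le_trans (measureReal_mono_pred fun E hE => ?_) hpow
    contrapose! hE
    refine Or.inr ⟨s, Finset.mem_Icc.2 ⟨hs1, hsp⟩, hdir, z, hz, ?_⟩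
    rw [hcon _ hGs0 hdir]
    exact hE
  · have hdir' : (2 : ℝ) ^ k < dirGroups A α p k s := by exact_mod_cast hdir
    have hlp : levelLog k ^ (3 * α) ≤ √p := by
      have h3 : 2 * A * (levelLog k ^ (3 * α) * levelLog k) ≤ 2 * A * (√p * levelLog k) := by
        rw [← Real.rpow_add_one (by linarith)]
        refine hk.trans (hdir'.le.trans (hGs2.trans ?_))
        rw [← mul_assoc]
        exact mul_le_mul_of_nonneg_left (by linarith) (by positivity)
      exact le_of_mul_le_mul_right (le_of_mul_le_mul_left h3 (by positivity)) (by linarith)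
    have hthr := coord_threshold_le (s := s) hα (by linarith : 2 * α ≤ A) hq hl hs' hp'
      (by linarith) hlp hG1 hG2 hD3
    set x : ℝ := 4 * (Real.exp 1 * (p : ℝ) ^ ((1 : ℝ) / denseGroups A k)) +
      4 * (denseGroups A k : ℝ) / q with hx
    have hx0 : 0 < x := by positivity
    obtain ⟨j, hj⟩ := exists_coord_ge (hl0 _) hx0 (by
      refine le_trans ?_ (hsig _ hG0 hGt)
      rw [le_div_iff₀ (by positivity)]
      refine le_trans ?_ hN
      calc s * x * (4 * (denseGroups A k : ℝ)) = s * (4 * denseGroups A k * x) := by ring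
        _ ≤ s * (D * ((p : ℝ) / s) ^ (2 / α)) := by gcongr
        _ = D * sparseRate p α s := by
          rw [sparseRate]
          ring
        _ ≤ _ := by gcongr; linarith) hs1
    have hb2 : coordThreshold p (denseGroups A k) ^ 2 =
        Real.exp 1 * (p : ℝ) ^ ((1 : ℝ) / denseGroups A k) := Real.sq_sqrt (by positivity)
    have hpow := (hnoise _ hG0 hGt).coord_power (b := coordThreshold p (denseGroups A k))
      (Real.sqrt_pos.2 (by positivity))
      (fun j => √(((2 ^ k / denseGroups A k : ℕ) : ℝ) / 2) * δ j) j (by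
        refine abs_le_of_sq_le_sq' ?_ (abs_nonneg _) |>.2
        rw [sq_abs, mul_pow, hb2]
        refine le_trans ?_ hj
        have : 0 ≤ 4 * (denseGroups A k : ℝ) / q := by positivity
        linarith)
    refine le_trans (measureReal_mono_pred fun E hE => ?_) (hpow.trans ?_)
    · contrapose! hE
      refine Or.inl ⟨hGt, Or.inr ?_⟩
      rw [hcon _ hG0 hGt]
      exact hE
    · rw [div_le_iff₀ (hx0.trans_le hj)]
      have h4 : 4 * (denseGroups A k : ℝ) / q ≤ x := by
        rw [hx]
        have : 0 ≤ Real.exp 1 * (p : ℝ) ^ ((1 : ℝ) / denseGroups A k) := by positivity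
        linarith
      have h5 := mul_le_mul_of_nonneg_left (h4.trans hj) hq.le
      rw [mul_div_cancel₀ _ hq.ne'] at h5
      have h6 := mul_nonneg hq.le (hx0.le.trans hj)
      linarith

theorem reject_boundary_power (hα : 4 ≤ α) (hK : 0 < K) (hP : P ∈ Pclass p n α K) (hp : 0 < p)
    (hq : 0 < q) (hc : 0 < c) (hcq : (3 + 2 * K ^ 4) / c ^ 2 + 4 / c ≤ q)
    {s : ℕ} {L : ℝ} (hs1 : 1 ≤ s) (h1 : 1 ≤ t0) (h2 : t0 + 1 ≤ n)
    (hθ₁ : ∀ t : Fin n, (t : ℕ) < t0 → θ t = μ₁) (hθ₂ : ∀ t : Fin n, t0 ≤ (t : ℕ) → θ t = μ₂)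
    (hs : l0 p (fun j => μ₁ j - μ₂ j) ≤ s) (hL1 : 8 * c ≤ L)
    (hL2 : 2 * (2 ^ α * (2 * (2 ^ α * (2 * K ^ α) / q)) + 1) ≤ L)
    (hN : L * min √p (sparseRate p α s) ≤ sqnorm p fun j => μ₁ j - μ₂ j) :
    P.real {E | ¬Reject p n α K A q c (θ + E)} ≤ 2 * q := by
  have hPP : IsProbabilityMeasure P := (isNoise_entries hα hK hP).indep.isProbabilityMeasure
  have hp' : (1 : ℝ) ≤ p := by exact_mod_cast hp
  set δ : Fin p → ℝ := fun j => μ₁ j - μ₂ j with hδ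
  have hcon := contrast_add_of_two_means (θ := θ) (μ₁ := μ₁) (μ₂ := μ₂) (G := 1) (m := 1) one_pos
    (by omega) (by omega) hθ₁ hθ₂
  have hsig : sqnorm p (fun j => √(((1 : ℕ) : ℝ) / 2) * δ j) = sqnorm p δ / 2 := by
    rw [sqnorm_const_mul, Real.sq_sqrt (by positivity), Nat.cast_one]
    ring
  have hl0 : ∀ a : ℝ, l0 p (fun j => a * δ j) ≤ s := fun a => (l0_const_mul_le a δ).trans hs
  rcases le_total √(p : ℝ) (sparseRate p α s) with hcase | hcase
  · rw [min_eq_left hcase] at hN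
    have hpow := (isNoise_contrast hα hK hP (G := 1) one_pos (by omega)).dense_power hc hcq hp
      one_pos (fun j => √(((1 : ℕ) : ℝ) / 2) * δ j) (by
        refine le_trans ?_ hsig.ge
        have := mul_le_mul_of_nonneg_right hL1 (Real.sqrt_nonneg p)
        linarith)
    refine le_trans (measureReal_mono_pred fun E hE => ?_) hpow
    contrapose! hE
    refine Or.inl (Or.inr ?_)
    rw [hcon]
    exact hE
  · rw [min_eq_right hcase] at hN
    have hM : 0 < 2 ^ α * (2 * (2 ^ α * (2 * K ^ α) / q)) := by positivity
    have hpow := pow_power (P := P) (B := 2 ^ α * (2 * K ^ α)) hp (by linarith) (by positivity) hq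
      (fun j => (contrast_one_one_rpow (by linarith) hK hP (by omega) 0 j).1)
      (fun j => (contrast_one_one_rpow (by linarith) hK hP (by omega) 0 j).2)
      (fun j => √(((1 : ℕ) : ℝ) / 2) * δ j) (by
        refine lt_of_lt_of_le ?_ (sum_rpow_ge (L := L / 2) hα (hl0 _) hs1 hp (by linarith) (by
          rw [hsig]
          linarith))
        calc _ = 2 ^ α * (2 * (2 ^ α * (2 * K ^ α) / q)) * p := by ring
          _ < _ := mul_lt_mul_of_pos_right (by linarith) (by linarith))
    refine le_trans (measureReal_mono_pred fun E hE => ?_) (hpow.trans (by linarith))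
    contrapose! hE
    refine Or.inl (Or.inl ?_)
    rw [hcon]
    exact hE

end Power

section Risk

variable {p n : ℕ} {α K A q c : ℝ} {P : Measure (Fin n → Fin p → ℝ)}

theorem reject_power (hα : 4 ≤ α) (hK : 0 < K) (hP : P ∈ Pclass p n α K) (hp : 0 < p)
    (hA : 8 + 2 * α ≤ A) (hq : 0 < q) (hc : 0 < c) (hcq : (3 + 2 * K ^ 4) / c ^ 2 + 4 / c ≤ q)
    {k₀ : ℕ} (hk₀ : ∀ k ≥ k₀, 2 * A * levelLog k ^ (3 * α + 1) ≤ 2 ^ k) {D : ℝ}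
    (hD1 : 32 * A * c ≤ D) (hD2 : 128 * A / q ≤ D) (hD3 : 8 * A * (12 + 8 * A / q) ≤ D)
    (hD4 : 8 * c * 2 ^ k₀ ≤ D)
    (hD5 : 2 * (2 ^ α * (2 * (2 ^ α * (2 * K ^ α) / q)) + 1) * 2 ^ k₀ ≤ D)
    {t0 s : ℕ} (ht0 : 1 ≤ t0) (ht0' : t0 + 1 ≤ n) (hs1 : 1 ≤ s) (hsp : s ≤ p) {ρ : ℝ}
    (hρ : 6 * D * min ((p : ℝ) ^ max ((2 : ℝ) / α) ((1 : ℝ) / 2) * LL n)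
      ((s : ℝ) * ((p : ℝ) / (s : ℝ)) ^ ((2 : ℝ) / α) + LL n) ≤ ρ ^ 2)
    {θ : Fin n → Fin p → ℝ} (hθ : θ ∈ ThetaAt p n t0 s ρ) :
    P.real {E | ¬Reject p n α K A q c (θ + E)} ≤ 2 * q := by
  have hPP : IsProbabilityMeasure P := (isNoise_entries hα hK hP).indep.isProbabilityMeasure
  obtain ⟨μ₁, μ₂, hθ₁, hθ₂, hs, hsig⟩ := hθ
  have hA0 : 0 < A := by linarith
  have hD0 : 0 < D := lt_of_lt_of_le (by positivity) hD2
  set N := sqnorm p fun j => μ₁ j - μ₂ j with hN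
  have hN0 : 0 ≤ N := Finset.sum_nonneg fun j _ => sq_nonneg _
  set T := min t0 (n - t0) with hT
  have hT1 : T ≠ 0 := by omega
  set k := Nat.log 2 T with hk
  have hkT : 2 ^ k ≤ T := Nat.pow_log_le_self 2 hT1
  have hTk : T < 2 ^ (k + 1) := Nat.lt_pow_succ_log_self one_lt_two T
  have hkr : k ∈ Finset.range (Nat.log 2 (n / 2) + 1) := by
    rw [Finset.mem_range, Nat.lt_succ_iff]
    exact Nat.log_mono_right (by omega)
  have hl := one_le_levelLog k
  have hLL := levelLog_le_three_mul_LL (n := n) (k := k) (by omega)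
  have hsr := le_sparseRate hα hs1 hsp
  have hs' : (1 : ℝ) ≤ s := by exact_mod_cast hs1
  have hρN : ρ ^ 2 ≤ 2 * (2 ^ k * N) := by
    refine hsig.trans ?_
    rw [← mul_assoc]
    refine mul_le_mul_of_nonneg_right ?_ hN0
    have hn0 : (0 : ℝ) < n := by exact_mod_cast (by omega : 0 < n)
    rw [div_le_iff₀ hn0]
    have h3 : t0 * (n - t0) ≤ T * n := by
      rcases le_total t0 (n - t0) with h | h
      · rw [hT, min_eq_left h]
        exact Nat.mul_le_mul_left _ (by omega)
      · rw [hT, min_eq_right h, mul_comm]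
        exact Nat.mul_le_mul_left _ (by omega)
    have h4 : t0 * (n - t0) ≤ 2 * 2 ^ k * n :=
      h3.trans (Nat.mul_le_mul_right _ (by rw [← pow_succ']; exact hTk.le))
    have h5 : ((t0 * (n - t0) : ℕ) : ℝ) ≤ ((2 * 2 ^ k * n : ℕ) : ℝ) := Nat.cast_le.2 h4
    rw [Nat.cast_mul, Nat.cast_sub (by omega)] at h5
    exact_mod_cast h5
  have hmax : max ((2 : ℝ) / α) ((1 : ℝ) / 2) = 1 / 2 := by
    refine max_eq_right ?_
    rw [div_le_div_iff₀ (by linarith) two_pos]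
    linarith
  rw [hmax, ← Real.sqrt_eq_rpow] at hρ
  change 6 * D * min (√p * LL n) (sparseRate p α s + LL n) ≤ ρ ^ 2 at hρ
  have hmin : min (√p * levelLog k) (sparseRate p α s + levelLog k) ≤
      3 * min (√p * LL n) (sparseRate p α s + LL n) := by
    rw [mul_min_of_nonneg _ _ (by norm_num : (0 : ℝ) ≤ 3)]
    refine min_le_min ?_ (by linarith)
    have := mul_le_mul_of_nonneg_left hLL (Real.sqrt_nonneg p)
    linarith
  have hkey : D * min (√p * levelLog k) (sparseRate p α s + levelLog k) ≤ 2 ^ k * N := by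
    have := mul_le_mul_of_nonneg_left hmin hD0.le
    linarith
  rcases le_or_gt k₀ k with hkk | hkk
  · refine le_trans (measureReal_mono_pred fun E hE => ?_)
      (rejectLevel_power hα hK hP hp hA hq hc hcq hs1 hsp (hk₀ k hkk) (t0 := t0) (by omega)
        (by omega) hθ₁ hθ₂ hs hD1 hD2 hD3 hkey)
    exact fun hlev => hE (Or.inr ⟨k, hkr, hlev⟩)
  · have h2k : (0 : ℝ) < 2 ^ k₀ := by positivity
    refine reject_boundary_power hα hK hP hp hq hc hcq hs1 ht0 ht0' hθ₁ hθ₂ hs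
      ((le_div_iff₀ h2k).2 hD4) ((le_div_iff₀ h2k).2 hD5) ?_
    rw [div_mul_eq_mul_div, div_le_iff₀ h2k]
    have h3 : min √(p : ℝ) (sparseRate p α s) ≤
        min (√p * levelLog k) (sparseRate p α s + levelLog k) :=
      min_le_min (le_mul_of_one_le_right (Real.sqrt_nonneg p) hl) (by linarith)
    have h4 : (2 : ℝ) ^ k ≤ 2 ^ k₀ := pow_le_pow_right₀ one_le_two hkk.le
    have h5 := mul_le_mul_of_nonneg_left h3 hD0.le
    have h6 := mul_le_mul_of_nonneg_right h4 hN0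
    linarith

theorem isTest_indicator {S : Set (Fin n → Fin p → ℝ)} (hS : MeasurableSet S) :
    IsTest p n (S.indicator 1) :=
  ⟨measurable_one.indicator hS, fun x => by
    by_cases h : x ∈ S <;> simp [h]⟩

theorem risk_indicator_le {Q : Set (Measure (Fin n → Fin p → ℝ))}
    {Θ S : Set (Fin n → Fin p → ℝ)} {a b : ℝ} (hS : MeasurableSet S) (ha : 0 ≤ a) (hb : 0 ≤ b)
    (h0 : ∀ P ∈ Q, ∀ θ ∈ Theta0 p n, P.real {E | θ + E ∈ S} ≤ a)
    (h1 : ∀ P ∈ Q, ∀ θ ∈ Θ, P.real {E | θ + E ∉ S} ≤ b) :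
    risk p n Q Θ (S.indicator 1) ≤ a + b := by
  have hmeas : ∀ θ : Fin n → Fin p → ℝ, MeasurableSet {E | θ + E ∈ S} := fun θ =>
    (measurable_const_add θ) hS
  refine add_le_add ?_ ?_
  · refine Real.iSup_le (fun P => Real.iSup_le (fun hP => Real.iSup_le (fun θ =>
      Real.iSup_le (fun hθ => ?_) ha) ha) ha) ha
    refine le_of_eq_of_le ?_ (h0 P hP θ hθ)
    rw [← integral_indicator_one (hmeas θ)]
    rfl
  · refine Real.iSup_le (fun P => Real.iSup_le (fun hP => Real.iSup_le (fun θ =>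
      Real.iSup_le (fun hθ => ?_) hb) hb) hb) hb
    refine le_of_eq_of_le ?_ (h1 P hP θ hθ)
    rw [← integral_indicator_one (s := {E | θ + E ∉ S}) (hmeas θ).compl]
    refine integral_congr_ae (ae_of_all _ fun E => ?_)
    by_cases h : θ + E ∈ S <;> simp [Set.indicator, h]

end Risk

/-- Theorem: adaptation to sparsity under finite-moment noise. -/
theorem statement_7 (α K ε : ℝ) (hα : 4 ≤ α) (hK : 0 < K) (hε0 : 0 < ε) (hε1 : ε < 1) :
    ∃ C : ℝ, 0 < C ∧
      ∀ p n : ℕ, 0 < p → 2 ≤ n →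
        ∃ φ : (Fin n → Fin p → ℝ) → ℝ, IsTest p n φ ∧
          ∀ s : ℕ, 1 ≤ s → s ≤ p → ∀ ρ : ℝ,
            C * min ((p : ℝ) ^ max ((2 : ℝ) / α) ((1 : ℝ) / 2) * LL n)
                ((s : ℝ) * ((p : ℝ) / (s : ℝ)) ^ ((2 : ℝ) / α) + LL n) ≤ ρ ^ 2 →
            risk p n (Pclass p n α K) (Theta1 p n s ρ) φ ≤ ε := by
  obtain ⟨q, hq_def⟩ : ∃ q, q = ε / 100 := ⟨_, rfl⟩
  obtain ⟨A, hA_def⟩ : ∃ A, A = 8 + 2 * α + 10 / ε := ⟨_, rfl⟩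
  obtain ⟨c, hc_def⟩ : ∃ c, c = (3 + 2 * K ^ 4 + 4) / q := ⟨_, rfl⟩
  have hq : 0 < q := by rw [hq_def]; positivity
  have hq1 : q ≤ 1 / 100 := by linarith
  have hεA : 0 < 10 / ε := by positivity
  have hA : 8 + 2 * α ≤ A := by linarith
  have hA0 : 0 < A := by linarith
  have hκ : 0 ≤ 2 * K ^ 4 := by positivity
  have hc : 0 < c := by rw [hc_def]; positivity
  have hcq : (3 + 2 * K ^ 4) / c ^ 2 + 4 / c ≤ q := by
    have hqc : q = (3 + 2 * K ^ 4 + 4) / c := by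
      rw [hc_def]
      field_simp
    have hc1 : 1 ≤ c := by
      rw [hc_def, le_div_iff₀ hq]
      linarith
    have : (3 + 2 * K ^ 4) / c ^ 2 ≤ (3 + 2 * K ^ 4) / c :=
      div_le_div_of_nonneg_left (by positivity) hc (le_self_pow₀ hc1 two_ne_zero)
    rw [add_div] at hqc
    linarith
  have hcq' : (3 + 2 * K ^ 4) / c ^ 2 ≤ q := by
    have : 0 ≤ 4 / c := by positivity
    linarith
  have hexp : Real.exp (-A) ≤ ε / 10 := by
    have h1 : 10 / ε ≤ Real.exp A := by linarith [Real.add_one_le_exp A]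
    have h2 := inv_anti₀ hεA h1
    rwa [← Real.exp_neg, inv_div] at h2
  obtain ⟨k₀, hk₀⟩ := exists_level_threshold A (3 * α + 1) hA0
  have e1 : 0 < 32 * A * c := by positivity
  have e2 : 0 < 128 * A / q := by positivity
  have e3 : 0 < 8 * A * (12 + 8 * A / q) := by positivity
  have e4 : 0 < 8 * c * 2 ^ k₀ := by positivity
  have e5 : 0 < 2 * (2 ^ α * (2 * (2 ^ α * (2 * K ^ α) / q)) + 1) * 2 ^ k₀ := by positivity
  refine ⟨6 * (32 * A * c + 128 * A / q + 8 * A * (12 + 8 * A / q) + 8 * c * 2 ^ k₀ +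
    2 * (2 ^ α * (2 * (2 ^ α * (2 * K ^ α) / q)) + 1) * 2 ^ k₀), by linarith,
    fun p n hp hn => ⟨{X | Reject p n α K A q c X}.indicator 1,
      isTest_indicator measurableSet_reject, fun s hs1 hsp ρ hρ => ?_⟩⟩
  refine (risk_indicator_le (a := ε / 2) (b := ε / 2) measurableSet_reject (by linarith)
    (by linarith) (fun P hP θ hθ => ?_) fun P hP θ hθ => ?_).trans (by linarith)
  · simp only [Set.mem_ofPred_eq, reject_add_of_mem_Theta0 hθ hn hA0]
    exact (reject_null hα hK hP hp hn hA hq hq1 hc hcq').trans (by linarith)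
  · simp only [Theta1, Set.mem_iUnion, exists_prop, Finset.mem_Icc] at hθ
    obtain ⟨t0, ⟨h1, h2⟩, hθ⟩ := hθ
    exact (reject_power hα hK hP hp hA hq hc hcq hk₀ (by linarith) (by linarith) (by linarith)
      (by linarith) (by linarith) h1 (by omega) hs1 hsp hρ hθ).trans (by linarith)

end ChangePoint
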